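/- arXiv:math/0703898 — 2 statements merged into one kernel-verified Lean document; each statement's English description precedes it below -/
import Mathlib

section
/- Let τ be the canonical sequence of a partition and let k ≥ 1. Then the pattern 12⋯k(τ+k)12⋯k is equivalent to the pattern 12⋯k(τ+k)k(k−1)⋯1, and the pattern 12⋯k12⋯k(τ+k) is equivalent to the pattern 12⋯k k(k−1)⋯1(τ+k). -/
/-- `π` is the canonical sequence of a set partition: every entry is at least 1,
and each entry is at most one more than the maximum of the preceding entries
(so the first entry is 1). -/
def IsCanonicalSeq (π : List ℕ) : Prop :=
  ∀ i (h : i < π.length), 1 ≤ π.get ⟨i, h⟩ ∧ π.get ⟨i, h⟩ ≤ (π.take i).foldr max 0 + 1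

/-- `π` contains the pattern `σ`: there is a subsequence of `π`
order-isomorphic to `σ`. -/
def ContainsPat (π σ : List ℕ) : Prop :=
  ∃ f : Fin σ.length → Fin π.length, StrictMono f ∧
    ∀ i j : Fin σ.length, σ.get i < σ.get j ↔ π.get (f i) < π.get (f j)

/-- `π` avoids the pattern `σ`. -/
def AvoidsPat (π σ : List ℕ) : Prop := ¬ ContainsPat π σ

/-- `pAvoid n σ` is the number of canonical sequences of partitions of `[n]`
avoiding the pattern `σ`. -/
noncomputable def pAvoid (n : ℕ) (σ : List ℕ) : ℕ :=
  Set.ncard {π : List ℕ | π.length = n ∧ IsCanonicalSeq π ∧ AvoidsPat π σ}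

/-- Two patterns are equivalent if they have the same number of avoiders of
each size. -/
def PatEquiv (σ σ' : List ℕ) : Prop := ∀ n, pAvoid n σ = pAvoid n σ'

/-- The increasing sequence `1, 2, …, k`. -/
def iota (k : ℕ) : List ℕ := (List.range k).map (· + 1)

namespace CrystalWord

/-- The number of letters `i + 1` left unmatched when each letter `i` is an opening bracket and
each letter `i + 1` a closing bracket. -/
def eps (i : ℕ) : List ℕ → ℕ
  | [] => 0
  | x :: w => if x = i then eps i w - 1 else if x = i + 1 then eps i w + 1 else eps i w

/-- The number of letters `i` left unmatched in the same bracketing. -/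
def phi (i : ℕ) : List ℕ → ℕ
  | [] => 0
  | x :: w => if x = i ∧ eps i w = 0 then phi i w + 1 else phi i w

/-- Rewrite the unmatched letters of a word so that exactly the first `n` of them are `i + 1`
and all the others are `i`. -/
def rewriteString (i : ℕ) : ℕ → List ℕ → List ℕ
  | _, [] => []
  | n, x :: w =>
    if (x = i ∧ eps i w = 0) ∨ x = i + 1 then
      if n = 0 then i :: rewriteString i 0 w else (i + 1) :: rewriteString i (n - 1) w
    else if x = i then i :: rewriteString i (n + 1) w else x :: rewriteString i n w

/-- Lowering operator of the crystal of words: the first unmatched `i` becomes `i + 1`. -/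
def Step (i : ℕ) (w w' : List ℕ) : Prop :=
  ∃ A B, w = A ++ i :: B ∧ w' = A ++ (i + 1) :: B ∧ phi i A = 0 ∧ eps i B = 0

lemma eps_le_append (i : ℕ) (A B : List ℕ) : eps i A ≤ eps i (A ++ B) := by
  induction A with
  | nil => simp [eps]
  | cons x A ih => simp only [List.cons_append, eps]; split_ifs <;> omega

lemma phi_append_eq_zero {i : ℕ} {A B : List ℕ} (hA : phi i A = 0) (hB : phi i B = 0) :
    phi i (A ++ B) = 0 := by
  induction A with
  | nil => simpa
  | cons x A ih =>
    have := eps_le_append i A B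
    simp only [List.cons_append, phi] at *
    grind

lemma eps_append_le (i : ℕ) (A : List ℕ) : eps i (A ++ [i + 1]) ≤ eps i A + 1 := by
  induction A with
  | nil => simp [eps]
  | cons x A ih => simp only [List.cons_append, eps]; split_ifs <;> omega

lemma eps_append_singleton (i : ℕ) (A : List ℕ) (h : eps i A < eps i (A ++ [i + 1])) :
    phi i A = 0 := by
  induction A with
  | nil => rfl
  | cons x A ih =>
    have := eps_le_append i A [i + 1]
    have := eps_append_le i A
    simp only [List.cons_append, eps, phi] at *
    grind

lemma eps_append_other (i x : ℕ) (A : List ℕ) (hx : x ≠ i + 1) :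
    eps i (A ++ [x]) = eps i A := by
  induction A with
  | nil => simp only [List.nil_append, eps]; grind
  | cons y A ih => simp only [List.cons_append, eps, ih]

lemma count_add_eps (i : ℕ) (w : List ℕ) :
    w.count i + eps i w = w.count (i + 1) + phi i w := by
  induction w with
  | nil => simp [eps, phi]
  | cons x w ih => simp only [eps, phi, List.count_cons]; grind

lemma rewriteString_spec (i : ℕ) (w : List ℕ) : ∀ n, n ≤ eps i w + phi i w →
    eps i (rewriteString i n w) = n ∧
    eps i (rewriteString i n w) + phi i (rewriteString i n w) = eps i w + phi i w := by
  induction w with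
  | nil => intro n hn; simp_all [eps, phi, rewriteString]
  | cons x w ih =>
    intro n hn
    have h0 := ih 0 (by omega)
    have h1 := ih (n - 1)
    have h2 := ih n
    have h3 := ih (n + 1)
    simp only [eps, phi, rewriteString] at *
    split_ifs at * <;> simp only [eps, phi] <;> grind

lemma rewriteString_rewriteString (i : ℕ) (w : List ℕ) : ∀ m n, n ≤ eps i w + phi i w →
    rewriteString i m (rewriteString i n w) = rewriteString i m w := by
  induction w with
  | nil => intro m n hn; simp [rewriteString]
  | cons x w ih =>
    intro m n hn
    have s0 := rewriteString_spec i w 0 (by omega)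
    have s1 := rewriteString_spec i w (n - 1)
    have s3 := rewriteString_spec i w (n + 1)
    simp only [eps, phi, rewriteString] at *
    split_ifs at * <;> simp only [rewriteString] <;> grind

lemma rewriteString_eps (i : ℕ) (w : List ℕ) : rewriteString i (eps i w) w = w := by
  induction w with
  | nil => rfl
  | cons x w ih =>
    simp only [eps, rewriteString] at *
    grind

lemma count_rewriteString_of_ne (i j n : ℕ) (w : List ℕ) (h : j ≠ i) (h' : j ≠ i + 1) :
    (rewriteString i n w).count j = w.count j := by
  induction w generalizing n with
  | nil => rfl
  | cons x w ih => simp only [rewriteString]; grind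

lemma count_rewriteString_add (i n : ℕ) (w : List ℕ) :
    (rewriteString i n w).count i + (rewriteString i n w).count (i + 1) =
      w.count i + w.count (i + 1) := by
  induction w generalizing n with
  | nil => rfl
  | cons x w ih =>
    simp only [rewriteString]
    have h0 := ih 0
    have h1 := ih (n - 1)
    have h2 := ih n
    have h3 := ih (n + 1)
    split_ifs <;> simp only [List.count_cons] <;> grind

lemma step_rewriteString (i : ℕ) (w : List ℕ) : ∀ n, n + 1 ≤ eps i w + phi i w →
    ∃ A B, rewriteString i n w = A ++ i :: B ∧ rewriteString i (n + 1) w = A ++ (i + 1) :: B ∧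
      phi i A = 0 ∧ eps i A = n ∧ eps i B = 0 := by
  induction w with
  | nil => intro n hn; simp [eps, phi] at hn
  | cons x w ih =>
    intro n hn
    simp only [eps, phi] at hn
    have s0 := rewriteString_spec i w 0 (by omega)
    by_cases hx : (x = i ∧ eps i w = 0) ∨ x = i + 1
    · simp only [rewriteString, if_pos hx]
      rcases n with _ | n
      · exact ⟨[], rewriteString i 0 w, by simp [phi, eps, s0.1]⟩
      · obtain ⟨A, B, h1, h2, h3, h4, h5⟩ := ih n (by grind)
        refine ⟨(i + 1) :: A, B, by simp [h1], by simp [h2], ?_, ?_, h5⟩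
        · simp [phi, h3]
        · simp [eps, h4]
    · by_cases hx' : x = i
      · obtain ⟨A, B, h1, h2, h3, h4, h5⟩ := ih (n + 1) (by grind)
        simp only [rewriteString, if_neg hx, if_pos hx']
        refine ⟨i :: A, B, by simp [h1], by simp [h2], ?_, ?_, h5⟩
        · simp [phi, h3, h4]
        · simp [eps, h4]
      · obtain ⟨A, B, h1, h2, h3, h4, h5⟩ := ih n (by grind)
        simp only [rewriteString, if_neg hx, if_neg hx']
        refine ⟨x :: A, B, by simp [h1], by simp [h2], ?_, ?_, h5⟩
        · simp [phi, hx', h3]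
        · simp [eps, hx', h4]; grind

lemma invariant_rewriteString {i : ℕ} {P : List ℕ → Prop}
    (hP : ∀ w w', Step i w w' → (P w ↔ P w')) (w : List ℕ) {n : ℕ}
    (hn : n ≤ eps i w + phi i w) : P (rewriteString i n w) ↔ P w := by
  have key : ∀ n, n ≤ eps i w + phi i w → (P (rewriteString i n w) ↔ P (rewriteString i 0 w)) := by
    intro n
    induction n with
    | zero => simp
    | succ n ih =>
      intro h
      obtain ⟨A, B, h1, h2, h3, -, h5⟩ := step_rewriteString i w n h
      rw [← ih (by omega)]
      exact (hP _ _ ⟨A, B, h1, h2, h3, h5⟩).symm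
  rw [key n hn, ← key (eps i w) (by omega), rewriteString_eps]

/-- `w` has a strictly increasing subsequence of length `k`. -/
def HasInc (k : ℕ) (w : List ℕ) : Prop :=
  ∃ c : List ℕ, c.Sublist w ∧ c.length = k ∧ c.Pairwise (· < ·)

lemma cons_sublist_of_eps {i : ℕ} {B c : List ℕ} (hB : eps i B = 0)
    (h : ((i + 1) :: c).Sublist B) : (i :: (i + 1) :: c).Sublist B := by
  induction B with
  | nil => simp at h
  | cons y B ih =>
    simp only [eps] at hB
    by_cases hy : y = i
    · subst hy
      have : ((y + 1) :: c).Sublist B := by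
        cases h with
        | cons _ h => exact h
      exact this.cons_cons y
    · by_cases hy' : y = i + 1
      · simp [hy'] at hB
      · simp only [hy, hy', if_false] at hB
        cases h with
        | cons _ h => exact (ih hB h).cons y
        | cons_cons _ h => exact absurd rfl hy'

lemma mem_of_eps_ne_zero {i : ℕ} {A : List ℕ} (h : eps i A ≠ 0) : i + 1 ∈ A := by
  induction A with
  | nil => simp [eps] at h
  | cons x A ih => simp only [eps] at h; grind

lemma append_sublist_of_phi {i : ℕ} {A : List ℕ} (hA : phi i A = 0) : ∀ c : List ℕ,
    (c ++ [i]).Sublist A → (c ++ [i, i + 1]).Sublist A := by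
  induction A with
  | nil => intro c h; simp at h
  | cons x A ih =>
    intro c h
    simp only [phi] at hA
    have hA' : phi i A = 0 := by grind
    rcases c with _ | ⟨y, c⟩
    · cases h with
      | cons _ h => exact (ih hA' [] h).cons x
      | cons_cons _ h =>
        have : i + 1 ∈ A := mem_of_eps_ne_zero (by grind)
        exact (List.singleton_sublist.2 this).cons_cons _
    · cases h with
      | cons _ h => exact (ih hA' (y :: c) h).cons x
      | cons_cons _ h => exact (ih hA' c h).cons_cons _

lemma pairwise_lt_replace {a d : List ℕ} {x y : ℕ} (h : (a ++ x :: d).Pairwise (· < ·))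
    (ha : ∀ u ∈ a, u < y) (hd : ∀ u ∈ d, y < u) : (a ++ y :: d).Pairwise (· < ·) := by
  rw [List.pairwise_append, List.pairwise_cons] at h ⊢
  refine ⟨h.1, ⟨hd, h.2.1.2⟩, fun u hu v hv => ?_⟩
  rcases List.mem_cons.1 hv with rfl | hv
  · exact ha u hu
  · exact h.2.2 u hu v (List.mem_cons_of_mem _ hv)

lemma hasInc_of_step {i k : ℕ} {w w' : List ℕ} (h : Step i w w') :
    HasInc k w ↔ HasInc k w' := by
  obtain ⟨A, B, rfl, rfl, hA, hB⟩ := h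
  constructor
  · rintro ⟨c, hc, hk, hs⟩
    obtain ⟨a, d, rfl, ha, hd⟩ := List.sublist_append_iff.1 hc
    cases hd with
    | cons _ hd => exact ⟨_, ha.append (hd.cons _), hk, hs⟩
    | @cons_cons d _ _ hd =>
      have hs' := hs
      rw [List.pairwise_append, List.pairwise_cons] at hs'
      obtain ⟨-, ⟨hd1, hd2⟩, had⟩ := hs'
      by_cases hmem : i + 1 ∈ d
      · obtain ⟨z, d, rfl⟩ := List.exists_cons_of_ne_nil (List.ne_nil_of_mem hmem)
        have hz : z = i + 1 := by
          have h1 := hd1 z (by simp)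
          rcases List.mem_cons.1 hmem with h | h
          · exact h.symm
          · have h2 := (List.pairwise_cons.1 hd2).1 _ h
            omega
        subst hz
        exact ⟨_, ha.append ((cons_sublist_of_eps hB hd).cons _), hk, hs⟩
      · refine ⟨a ++ (i + 1) :: d, ha.append (hd.cons_cons _), by simpa using hk,
          pairwise_lt_replace hs (fun u hu => ?_) fun u hu => ?_⟩
        · exact (had u hu i (by simp)).trans (Nat.lt_succ_self i)
        · exact lt_of_le_of_ne (hd1 u hu) (fun h => hmem (h ▸ hu))
  · rintro ⟨c, hc, hk, hs⟩
    obtain ⟨a, d, rfl, ha, hd⟩ := List.sublist_append_iff.1 hc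
    cases hd with
    | cons _ hd => exact ⟨_, ha.append (hd.cons _), hk, hs⟩
    | @cons_cons d _ _ hd =>
      have hs' := hs
      rw [List.pairwise_append, List.pairwise_cons] at hs'
      obtain ⟨ha2, ⟨hd1, hd2⟩, had⟩ := hs'
      by_cases hmem : i ∈ a
      · rcases a.eq_nil_or_concat with rfl | ⟨a, z, rfl⟩
        · simp at hmem
        · rw [List.concat_eq_append] at *
          have hz : z = i := by
            have h1 := had z (by simp) (i + 1) (by simp)
            rcases List.mem_append.1 hmem with h | h
            · have h2 := (List.pairwise_append.1 ha2).2.2 i h z (by simp)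
              omega
            · exact (List.mem_singleton.1 h).symm
          subst hz
          have := (append_sublist_of_phi hA a ha).append (hd.cons z)
          exact ⟨_, by simpa using this, by simpa using hk, by simpa using hs⟩
      · refine ⟨a ++ i :: d, ha.append (hd.cons_cons _), by simpa using hk,
          pairwise_lt_replace hs (fun u hu => ?_) fun u hu => ?_⟩
        · have h1 := had u hu (i + 1) (by simp)
          have h2 : u ≠ i := fun h => hmem (h ▸ hu)
          omega
        · exact (Nat.lt_succ_self i).trans (hd1 u hu)

lemma Step.filter {i b : ℕ} {w w' : List ℕ} (h : Step i w w') (hb : i + 1 ≤ b) :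
    Step i (w.filter (· ≤ b)) (w'.filter (· ≤ b)) := by
  obtain ⟨A, B, rfl, rfl, hA, hB⟩ := h
  have he : ∀ l : List ℕ, eps i (l.filter (· ≤ b)) = eps i l := by
    intro l
    induction l with
    | nil => rfl
    | cons x l ih => simp only [List.filter_cons, eps]; split_ifs <;> simp_all [eps] <;> omega
  have hp : ∀ l : List ℕ, phi i (l.filter (· ≤ b)) = phi i l := by
    intro l
    induction l with
    | nil => rfl
    | cons x l ih =>
      have := he l
      simp only [List.filter_cons, phi]
      split_ifs <;> simp_all [phi] <;> omega
  exact ⟨A.filter (· ≤ b), B.filter (· ≤ b), by simp [List.filter_append, List.filter_cons]; omega,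
    by simp [List.filter_append, List.filter_cons]; omega, by rw [hp, hA], by rw [he, hB]⟩

lemma Step.cons {i x x' : ℕ} {w w' : List ℕ} (h : Step i (x :: w) (x' :: w')) :
    (w = w' ∧ x = i ∧ x' = i + 1) ∨ (Step i w w' ∧ x = x') := by
  obtain ⟨A, B, h1, h2, hA, hB⟩ := h
  rcases A with _ | ⟨y, A⟩
  · left; simp_all
  · right
    simp only [List.cons_append, List.cons.injEq] at h1 h2
    refine ⟨⟨A, B, h1.2, h2.2, ?_, hB⟩, by rw [h1.1, h2.1]⟩
    simp only [phi] at hA; grind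

lemma Step.concat {i x x' : ℕ} {w w' : List ℕ} (h : Step i (w ++ [x]) (w' ++ [x'])) :
    (w = w' ∧ x = i ∧ x' = i + 1) ∨ (Step i w w' ∧ x = x') := by
  obtain ⟨A, B, h1, h2, hA, hB⟩ := h
  rcases B.eq_nil_or_concat with rfl | ⟨B, y, rfl⟩
  · left
    have := List.append_inj' h1 rfl
    have := List.append_inj' h2 rfl
    simp_all
  · right
    rw [List.concat_eq_append] at *
    rw [← List.cons_append, ← List.append_assoc] at h1 h2
    have h1 := List.append_inj' h1 rfl
    have h2 := List.append_inj' h2 rfl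
    refine ⟨⟨A, B, h1.1, h2.1, hA, ?_⟩, by simp_all⟩
    have := eps_le_append i B [y]
    omega

lemma Step.append_left {i : ℕ} {A w w' : List ℕ} (h : Step i w w') (hA : phi i A = 0) :
    Step i (A ++ (i + 1) :: w) (A ++ (i + 1) :: w') := by
  obtain ⟨P, Q, rfl, rfl, hP, hQ⟩ := h
  refine ⟨A ++ (i + 1) :: P, Q, by simp, by simp, phi_append_eq_zero hA ?_, hQ⟩
  simp [phi, hP]

/-- `P` is invariant under the crystal operators on the letters `1, …, b`. -/
def StepClosed (b : ℕ) (P : List ℕ → Prop) : Prop :=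
  ∀ i w v, 1 ≤ i → i + 1 ≤ b → Step i w v → (P w ↔ P v)

/-- Highest weight words for the letters `1, …, b`. -/
def Ballot (b : ℕ) (w : List ℕ) : Prop := ∀ i, 1 ≤ i → i + 1 ≤ b → eps i w = 0

/-- The numbers of occurrences of the letters `1, …, b`. -/
def wt (b : ℕ) (w : List ℕ) : Fin b → ℤ := fun j => w.count (j.val + 1)

/-- The staircase vector `(b - 1, …, 1, 0)`. -/
def staircase (b : ℕ) : Fin b → ℤ := fun j => b - 1 - j

/-- The weight shifted by the staircase vector. -/
def swt (b : ℕ) (w : List ℕ) : Fin b → ℤ := wt b w + staircase b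

/-- Functions on weights that change by the sign under permutations of the coordinates. -/
def Antisymm {b : ℕ} (f : (Fin b → ℤ) → ℤ) : Prop :=
  ∀ (σ : Equiv.Perm (Fin b)) γ, f (γ ∘ σ) = Equiv.Perm.sign σ * f γ

lemma eps_append_succ {i : ℕ} {A : List ℕ} (hA : phi i A = 0) :
    eps i (A ++ [i + 1]) = eps i A + 1 := by
  induction A with
  | nil => simp [eps]
  | cons x A ih =>
    simp only [List.cons_append, eps, phi] at *
    grind

/-- `A ++ (i + 1) :: B` is the decomposition of `w` at its first letter violating the ballot
condition. -/
structure Violation (b : ℕ) (w A : List ℕ) (i : ℕ) (B : List ℕ) : Prop where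
  eq : w = A ++ (i + 1) :: B
  ballot : Ballot b A
  one_le : 1 ≤ i
  le : i + 1 ≤ b
  phi_eq : phi i A = 0

lemma Violation.not_ballot {b i : ℕ} {w A B : List ℕ} (h : Violation b w A i B) :
    ¬ Ballot b w := by
  intro hw
  have h1 := hw i h.one_le h.le
  have h2 := eps_append_succ h.phi_eq
  have h3 := eps_le_append i (A ++ [i + 1]) B
  rw [h.eq] at h1
  simp only [List.append_assoc, List.singleton_append] at h3
  omega

lemma exists_violation {b : ℕ} {w : List ℕ} (h : ¬ Ballot b w) :
    ∃ A i B, Violation b w A i B := by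
  induction w using List.reverseRecOn with
  | nil => exact absurd (fun _ _ _ => rfl) h
  | append_singleton w x ih =>
    by_cases hw : Ballot b w
    · unfold Ballot at h
      push Not at h
      obtain ⟨i, h1, h2, h3⟩ := h
      have h0 := hw i h1 h2
      by_cases hx : x = i + 1
      · subst hx
        exact ⟨w, i, [], rfl, hw, h1, h2, eps_append_singleton i w (by omega)⟩
      · exact absurd (by rw [eps_append_other i x w hx, h0]) h3
    · obtain ⟨A, i, B, hv⟩ := ih hw
      exact ⟨A, i, B ++ [x], by rw [hv.eq]; simp, hv.ballot, hv.one_le, hv.le, hv.phi_eq⟩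

lemma Violation.length_le {b i j : ℕ} {w A B A' B' : List ℕ} (h : Violation b w A i B)
    (h' : Violation b w A' j B') : A'.length ≤ A.length := by
  by_contra! hlt
  have h1 : (A ++ [i + 1]) <+: A' := by
    apply List.prefix_of_prefix_length_le (l₃ := w)
    · exact ⟨B, by rw [h.eq]; simp⟩
    · exact ⟨_, h'.eq.symm⟩
    · simpa using hlt
  obtain ⟨C, rfl⟩ := h1
  have h2 := eps_le_append i (A ++ [i + 1]) C
  rw [h'.ballot i h.one_le h.le, eps_append_succ h.phi_eq] at h2
  omega

lemma Violation.unique {b i j : ℕ} {w A B A' B' : List ℕ} (h : Violation b w A i B)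
    (h' : Violation b w A' j B') : A = A' ∧ i = j ∧ B = B' := by
  have hl := le_antisymm (h'.length_le h) (h.length_le h')
  have he := List.append_inj (h.eq.symm.trans h'.eq) hl
  simp only [List.cons.injEq] at he
  exact ⟨he.1, by omega, he.2.2⟩

/-- Reflect the part of a word after its first violation of the ballot condition. -/
noncomputable def reflect (b : ℕ) (w : List ℕ) (h : ¬ Ballot b w) : List ℕ :=
  let A := (exists_violation h).choose
  let i := (exists_violation h).choose_spec.choose
  let B := (exists_violation h).choose_spec.choose_spec.choose
  A ++ (i + 1) :: rewriteString i (phi i B) B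

lemma Violation.reflect_eq {b i : ℕ} {w A B : List ℕ} (h : Violation b w A i B)
    (hw : ¬ Ballot b w) : reflect b w hw = A ++ (i + 1) :: rewriteString i (phi i B) B := by
  obtain ⟨h1, h2, h3⟩ :=
    h.unique (exists_violation hw).choose_spec.choose_spec.choose_spec
  have key : ∀ A' i' B', A = A' → i = i' → B = B' →
      A' ++ (i' + 1) :: rewriteString i' (phi i' B') B' =
        A ++ (i + 1) :: rewriteString i (phi i B) B := by
    rintro _ _ _ rfl rfl rfl; rfl
  exact key _ _ _ h1 h2 h3

lemma Violation.rewrite {b i : ℕ} {w A B : List ℕ} (h : Violation b w A i B) (B' : List ℕ) :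
    Violation b (A ++ (i + 1) :: B') A i B' :=
  ⟨rfl, h.ballot, h.one_le, h.le, h.phi_eq⟩

lemma rewriteString_phi_phi (i : ℕ) (B : List ℕ) :
    rewriteString i (phi i (rewriteString i (phi i B) B)) (rewriteString i (phi i B) B) = B := by
  have h := rewriteString_spec i B (phi i B) (by omega)
  have : phi i (rewriteString i (phi i B) B) = eps i B := by omega
  rw [this, rewriteString_rewriteString i B _ _ (by omega), rewriteString_eps]

lemma count_rewriteString_phi (i : ℕ) (B : List ℕ) :
    (rewriteString i (phi i B) B).count i = B.count (i + 1) ∧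
    (rewriteString i (phi i B) B).count (i + 1) = B.count i := by
  have h := rewriteString_spec i B (phi i B) (by omega)
  have h1 := count_add_eps i B
  have h2 := count_add_eps i (rewriteString i (phi i B) B)
  have h3 := count_rewriteString_add i (phi i B) B
  omega

lemma Antisymm.swap {b i : ℕ} {f : (Fin b → ℤ) → ℤ} (hf : Antisymm f) (hi : 1 ≤ i)
    (hib : i + 1 ≤ b) {γ γ' : Fin b → ℤ} (h1 : γ' ⟨i - 1, by omega⟩ = γ ⟨i, by omega⟩)
    (h2 : γ' ⟨i, by omega⟩ = γ ⟨i - 1, by omega⟩)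
    (h3 : ∀ j : Fin b, j.val ≠ i → j.val ≠ i - 1 → γ' j = γ j) : f γ + f γ' = 0 := by
  have hne : (⟨i - 1, by omega⟩ : Fin b) ≠ ⟨i, by omega⟩ := by simp; omega
  have : γ' = γ ∘ Equiv.swap (⟨i - 1, by omega⟩ : Fin b) ⟨i, by omega⟩ := by
    funext j
    simp only [Function.comp, Equiv.swap_apply_def]
    split_ifs with ha hb
    · rw [ha, h1]
    · rw [hb, h2]
    · exact h3 j (fun h => hb (Fin.ext h)) (fun h => ha (Fin.ext h))
  rw [this, hf, Equiv.Perm.sign_swap hne]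
  simp

lemma Violation.sum_eq_zero {b i : ℕ} {w A B : List ℕ} (h : Violation b w A i B)
    {f : (Fin b → ℤ) → ℤ} (hf : Antisymm f) :
    f (swt b w) + f (swt b (A ++ (i + 1) :: rewriteString i (phi i B) B)) = 0 := by
  have hi := h.one_le
  have hib := h.le
  have hc := count_rewriteString_phi i B
  have hA := count_add_eps i A
  rw [h.ballot i hi hib, h.phi_eq] at hA
  have hi' : i - 1 + 1 = i := by omega
  apply hf.swap hi hib
  · simp only [swt, wt, staircase, Pi.add_apply, h.eq, hi', List.count_append, List.count_cons, hc]
    grind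
  · simp only [swt, wt, staircase, Pi.add_apply, h.eq, hi', List.count_append, List.count_cons, hc]
    grind
  · intro j hj hj'
    simp only [swt, wt, staircase, Pi.add_apply, h.eq, List.count_append, List.count_cons]
    rw [count_rewriteString_of_ne i (j.val + 1) _ B (by omega) (by omega)]

open Classical in
lemma sum_eq_sum_ballot {b : ℕ} {X : Finset (List ℕ)} (hX : StepClosed b (· ∈ X))
    {f : (Fin b → ℤ) → ℤ} (hf : Antisymm f) :
    ∑ w ∈ X, f (swt b w) = ∑ w ∈ X with Ballot b w, f (swt b w) := by
  rw [← Finset.sum_filter_add_sum_filter_not X (Ballot b), add_eq_left]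
  refine Finset.sum_involution
    (fun w hw => reflect b w (Finset.mem_filter.1 hw).2) ?_ ?_ ?_ ?_
  · intro w hw
    obtain ⟨A, i, B, hv⟩ := exists_violation (Finset.mem_filter.1 hw).2
    rw [hv.reflect_eq]
    exact hv.sum_eq_zero hf
  · intro w hw h0 h
    obtain ⟨A, i, B, hv⟩ := exists_violation (Finset.mem_filter.1 hw).2
    rw [hv.reflect_eq] at h
    have := hv.sum_eq_zero hf
    rw [h] at this
    omega
  · intro w hw
    obtain ⟨A, i, B, hv⟩ := exists_violation (Finset.mem_filter.1 hw).2
    rw [hv.reflect_eq, Finset.mem_filter]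
    refine ⟨?_, (hv.rewrite _).not_ballot⟩
    refine (invariant_rewriteString (P := fun u => A ++ (i + 1) :: u ∈ X) ?_ B (by omega)).2 ?_
    · intro u u' hu
      exact hX i _ _ hv.one_le hv.le (hu.append_left hv.phi_eq)
    · rw [← hv.eq]
      exact (Finset.mem_filter.1 hw).1
  · intro w hw
    obtain ⟨A, i, B, hv⟩ := exists_violation (Finset.mem_filter.1 hw).2
    have hr := hv.rewrite (rewriteString i (phi i B) B)
    simp only [hv.reflect_eq]
    rw [hr.reflect_eq hr.not_ballot, rewriteString_phi_phi, ← hv.eq]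

lemma Ballot.count_succ_le {b i : ℕ} {w : List ℕ} (h : Ballot b w) (hi : 1 ≤ i)
    (hib : i + 1 ≤ b) : w.count (i + 1) ≤ w.count i := by
  have := count_add_eps i w
  have := h i hi hib
  omega

lemma Ballot.count_le {b i j : ℕ} {w : List ℕ} (h : Ballot b w) (hi : 1 ≤ i) (hij : i ≤ j)
    (hj : j ≤ b) : w.count j ≤ w.count i := by
  induction j, hij using Nat.le_induction with
  | base => rfl
  | succ j hij ih => exact (h.count_succ_le (by omega) hj).trans (ih (by omega))

lemma Ballot.range'_sublist {b k m : ℕ} {w : List ℕ} (h : Ballot b w) (hk : m + 1 + k ≤ b)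
    (hmem : m + 1 + k ∈ w) : (List.range' (m + 1) (k + 1)).Sublist w := by
  induction k generalizing m with
  | zero => simpa using hmem
  | succ k ih =>
    have := ih (m := m + 1) (by omega) (by convert hmem using 1; omega)
    rw [List.range'_succ] at this ⊢
    rw [List.range'_succ]
    exact cons_sublist_of_eps (h (m + 1) (by omega) (by omega)) this

lemma exists_mem_ge_of_pairwise {c : List ℕ} {m : ℕ} (hc : c.Pairwise (· < ·)) (hne : c ≠ [])
    (hm : ∀ x ∈ c, m ≤ x) : ∃ x ∈ c, m + c.length ≤ x + 1 := by
  induction c generalizing m with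
  | nil => exact absurd rfl hne
  | cons y c ih =>
    rw [List.pairwise_cons] at hc
    rcases eq_or_ne c [] with rfl | hc'
    · exact ⟨y, by simp, by simpa using hm y⟩
    · obtain ⟨x, hx, h⟩ := ih (m := m + 1) hc.2 hc' fun x hx =>
        (Nat.succ_le_succ (hm y (by simp))).trans (hc.1 x hx)
      exact ⟨x, by simp [hx], by simp; omega⟩

lemma Ballot.hasInc_iff {b k : ℕ} {w : List ℕ} (h : Ballot b w) (hk : 1 ≤ k)
    (hpos : ∀ x ∈ w, 1 ≤ x) : HasInc k (w.filter (· ≤ b)) ↔ k ≤ b ∧ 1 ≤ w.count k := by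
  constructor
  · rintro ⟨c, hc, rfl, hs⟩
    have hmem : ∀ x ∈ c, x ∈ w ∧ x ≤ b := fun x hx => by
      simpa using hc.subset hx
    obtain ⟨x, hx, hlen⟩ := exists_mem_ge_of_pairwise hs (List.ne_nil_of_length_pos hk)
      (fun x hx => hpos x (hmem x hx).1)
    refine ⟨by have := (hmem x hx).2; omega, ?_⟩
    exact (List.count_pos_iff.2 (hmem x hx).1).trans_le
      (h.count_le hk (by omega) (hmem x hx).2)
  · rintro ⟨hkb, hw⟩
    obtain ⟨k, rfl⟩ : ∃ l, k = l + 1 := ⟨k - 1, by omega⟩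
    have hmem : 0 + 1 + k ∈ w := List.count_pos_iff.1 (by rwa [show 0 + 1 + k = k + 1 by omega])
    have hs := h.range'_sublist (by omega) hmem
    refine ⟨List.range' 1 (k + 1), ?_, by simp, List.pairwise_lt_range'⟩
    have hf := hs.filter (· ≤ b)
    rwa [List.filter_eq_self.2 (fun x hx => by simp [List.mem_range'] at hx ⊢; omega)] at hf

lemma Ballot.hasInc_iff_card {b k : ℕ} {w : List ℕ} (h : Ballot b w) (hk : 1 ≤ k)
    (hpos : ∀ x ∈ w, 1 ≤ x) :
    HasInc k (w.filter (· ≤ b)) ↔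
      k ≤ (Finset.univ.filter fun j : Fin b => (b : ℤ) - k < swt b w j).card := by
  rw [h.hasInc_iff hk hpos]
  have hanti : ∀ j j' : Fin b, j ≤ j' → swt b w j' ≤ swt b w j := by
    intro j j' hj
    have := h.count_le (i := j + 1) (j := j' + 1) (by omega) (by simpa using hj) (by omega)
    have hj' : j.val ≤ j'.val := hj
    simp only [swt, wt, staircase, Pi.add_apply]
    omega
  constructor
  · rintro ⟨hkb, hc⟩
    have hk' : swt b w ⟨k - 1, by omega⟩ > (b : ℤ) - k := by
      simp only [swt, wt, staircase, Pi.add_apply, Nat.sub_add_cancel hk]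
      omega
    calc k = (Finset.univ.filter fun j : Fin b => j.val < k).card := by
          rw [Fin.card_filter_val_lt]; omega
      _ ≤ _ := by
        apply Finset.card_le_card
        intro j hj
        simp only [Finset.mem_filter, Finset.mem_univ, true_and] at hj ⊢
        exact lt_of_lt_of_le hk' (hanti j _ (Fin.le_def.2 (by simp; omega)))
  · intro hc
    have hkb : k ≤ b := hc.trans ((Finset.card_le_univ _).trans (by simp))
    refine ⟨hkb, ?_⟩
    have hk' : swt b w ⟨k - 1, by omega⟩ > (b : ℤ) - k := by
      by_contra hcon
      have : (Finset.univ.filter fun j : Fin b => (b : ℤ) - k < swt b w j) ⊆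
          Finset.univ.filter fun j : Fin b => j.val < k - 1 := by
        intro j hj
        simp only [Finset.mem_filter, Finset.mem_univ, true_and] at hj ⊢
        by_contra hlt
        exact hcon (hj.trans_le (hanti _ j (Fin.le_def.2 (by simp; omega))))
      have := Finset.card_le_card this
      rw [Fin.card_filter_val_lt] at this
      omega
    simp only [swt, wt, staircase, Pi.add_apply, Nat.sub_add_cancel hk] at hk'
    omega

/-- The two sets of words have the same weight generating function for the letters
`1, …, b`. -/
def SameWeights (b : ℕ) (X X' : Finset (List ℕ)) : Prop :=
  ∀ F : (Fin b → ℤ) → ℤ, ∑ w ∈ X, F (wt b w) = ∑ w ∈ X', F (wt b w)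

open Classical in
lemma stepClosed_filter {b b' k : ℕ} {X : Finset (List ℕ)} (hX : StepClosed b' (· ∈ X))
    (hb : b' ≤ b) :
    StepClosed b' (· ∈ X.filter fun w => ¬ HasInc k (w.filter (· ≤ b))) := by
  intro i w w' h1 h2 hs
  have := hX i w w' h1 h2 hs
  simp only [Finset.mem_filter, hasInc_of_step (hs.filter (h2.trans hb))] at this ⊢
  rw [this]

open Classical in
lemma sum_filter_not_hasInc {b k : ℕ} (hk : 1 ≤ k) {X : Finset (List ℕ)}
    (hX : StepClosed b (· ∈ X)) (hpos : ∀ w ∈ X, ∀ x ∈ w, 1 ≤ x) {f : (Fin b → ℤ) → ℤ}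
    (hf : Antisymm f) :
    ∑ w ∈ X with ¬ HasInc k (w.filter (· ≤ b)), f (swt b w) =
      ∑ w ∈ X, if (Finset.univ.filter fun j : Fin b => (b : ℤ) - k < swt b w j).card < k
        then f (swt b w) else 0 := by
  have hf' : Antisymm (fun γ : Fin b → ℤ =>
      if (Finset.univ.filter fun j : Fin b => (b : ℤ) - k < γ j).card < k
        then f γ else 0) := by
    intro σ γ
    have : (Finset.univ.filter fun j : Fin b => (b : ℤ) - k < (γ ∘ σ) j).card =
        (Finset.univ.filter fun j : Fin b => (b : ℤ) - k < γ j).card := by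
      apply Finset.card_equiv σ
      simp
    simp only [this, hf σ γ, mul_ite, mul_zero]
  rw [sum_eq_sum_ballot (stepClosed_filter hX le_rfl) hf, sum_eq_sum_ballot hX hf',
    Finset.filter_filter,
    ← Finset.sum_filter, Finset.filter_filter]
  congr 1
  apply Finset.filter_congr
  intro w hw
  constructor
  · rintro ⟨h1, h2⟩
    rw [h2.hasInc_iff_card hk (hpos w hw)] at h1
    exact ⟨h2, by omega⟩
  · rintro ⟨h1, h2⟩
    rw [h1.hasInc_iff_card hk (hpos w hw)]
    exact ⟨by omega, h1⟩

lemma sum_comp_perm {b : ℕ} {X : Finset (List ℕ)} (hX : StepClosed b (· ∈ X))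
    (σ : Equiv.Perm (Fin b)) (F : (Fin b → ℤ) → ℤ) :
    ∑ w ∈ X, F (wt b w ∘ σ) = ∑ w ∈ X, F (wt b w) := by
  rcases b with _ | b
  · rw [Subsingleton.elim σ 1]; rfl
  have hσ : σ ∈ Submonoid.closure
      (Set.range fun i : Fin b => Equiv.swap i.castSucc i.succ) := by
    rw [Equiv.Perm.mclosure_swap_castSucc_succ]; trivial
  induction hσ using Submonoid.closure_induction generalizing F with
  | one => rfl
  | mul σ τ _ _ h1 h2 =>
    exact (h1 fun γ => F (γ ∘ τ)).trans (h2 F)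
  | mem σ h =>
    obtain ⟨i, rfl⟩ := h
    have hmem : ∀ w ∈ X, rewriteString (i + 1) (phi (i + 1) w) w ∈ X := fun w hw =>
      (invariant_rewriteString (P := (· ∈ X))
        (fun u u' hu => hX (i + 1) u u' (by omega) (by omega) hu) w (by omega)).2 hw
    refine Finset.sum_nbij' (fun w => rewriteString (i + 1) (phi (i + 1) w) w)
      (fun w => rewriteString (i + 1) (phi (i + 1) w) w) hmem hmem
      (fun w _ => rewriteString_phi_phi _ w) (fun w _ => rewriteString_phi_phi _ w) ?_
    intro w hw
    congr 1
    funext j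
    have hc := count_rewriteString_phi (i + 1) w
    simp only [Function.comp, Equiv.swap_apply_def, wt]
    split_ifs with ha hb
    · subst ha; simp [hc.1]
    · subst hb; simp [hc.2]
    · have ha' : j.val ≠ i := fun h => ha (Fin.ext h)
      have hb' : j.val ≠ i + 1 := fun h => hb (Fin.ext h)
      rw [count_rewriteString_of_ne _ _ _ _ (by omega) (by omega)]

lemma perm_eq_one_of_monotone {b : ℕ} {σ : Equiv.Perm (Fin b)} (h : Monotone σ) : σ = 1 := by
  have hs : StrictMono σ := h.strictMono_of_injective σ.injective
  have : hs.orderIsoOfSurjective σ σ.surjective = OrderIso.refl _ := Subsingleton.elim _ _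
  ext j
  have := congrArg (fun e : Fin b ≃o Fin b => (e j).val) this
  simpa using this

lemma staircase_strictAnti (b : ℕ) : StrictAnti (staircase b) := by
  intro i j h
  have : i.val < j.val := h
  simp only [staircase]
  omega

lemma sum_sq_lt {b : ℕ} {α : Fin b → ℤ} (hα : Antitone α) {σ : Equiv.Perm (Fin b)} (hσ : σ ≠ 1) :
    ∑ j, α j ^ 2 < ∑ j, ((α + staircase b) (σ j) - staircase b j) ^ 2 := by
  have hs : StrictAnti (α + staircase b) := fun i j h =>
    add_lt_add_of_le_of_lt (hα h.le) (staircase_strictAnti b h)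
  have hm : Monovary (α + staircase b) (staircase b) := by
    intro i j h
    exact (hs ((staircase_strictAnti b).lt_iff_gt.1 h)).le
  have hlt := (hm.sum_comp_perm_mul_lt_sum_mul_iff (σ := σ)).2 (by
    intro hcon
    apply hσ
    apply perm_eq_one_of_monotone
    intro i j hij
    rcases hij.eq_or_lt with rfl | hij
    · rfl
    · exact hs.le_iff_ge.1 (hcon (staircase_strictAnti b hij)))
  have hsq : ∑ j, (α + staircase b) (σ j) ^ 2 = ∑ j, (α + staircase b) j ^ 2 :=
    Equiv.sum_comp σ fun j => (α + staircase b) j ^ 2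
  have h1 : ∀ j, α j ^ 2 = (α + staircase b) j ^ 2 + staircase b j ^ 2 -
      2 * ((α + staircase b) j * staircase b j) := by
    intro j; simp only [Pi.add_apply]; ring
  have h2 : ∀ j, ((α + staircase b) (σ j) - staircase b j) ^ 2 =
      (α + staircase b) (σ j) ^ 2 + staircase b j ^ 2 -
        2 * ((α + staircase b) (σ j) * staircase b j) := by
    intro j; ring
  simp only [h1, h2, Finset.sum_sub_distrib, Finset.sum_add_distrib, ← Finset.mul_sum, hsq]
  linarith

/-- The difference of the weight generating functions of `Y` and `Y'`, evaluated at `α`. -/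
def weightDiff (b : ℕ) (Y Y' : Finset (List ℕ)) (α : Fin b → ℤ) : ℤ :=
  (∑ w ∈ Y, if wt b w = α then 1 else 0) - ∑ w ∈ Y', if wt b w = α then 1 else 0

lemma weightDiff_comp {b : ℕ} {Y Y' : Finset (List ℕ)} (hY : StepClosed b (· ∈ Y))
    (hY' : StepClosed b (· ∈ Y')) (σ : Equiv.Perm (Fin b)) (α : Fin b → ℤ) :
    weightDiff b Y Y' (α ∘ σ) = weightDiff b Y Y' α := by
  have : ∀ γ : Fin b → ℤ, γ ∘ σ = α ∘ σ ↔ γ = α := fun γ =>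
    ⟨fun h => funext fun j => by simpa using congrFun h (σ.symm j), fun h => by rw [h]⟩
  unfold weightDiff
  rw [← sum_comp_perm hY σ fun γ => if γ = α ∘ σ then 1 else 0,
    ← sum_comp_perm hY' σ fun γ => if γ = α ∘ σ then 1 else 0]
  simp only [this]

lemma weightDiff_eq_zero_of_antitone {b : ℕ} {Y Y' : Finset (List ℕ)}
    (h : ∀ f : (Fin b → ℤ) → ℤ, Antisymm f →
      ∑ w ∈ Y, f (swt b w) = ∑ w ∈ Y', f (swt b w)) {α : Fin b → ℤ} (hα : Antitone α)
    (hmax : ∀ β : Fin b → ℤ, ∑ j, α j ^ 2 < ∑ j, β j ^ 2 → weightDiff b Y Y' β = 0) :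
    weightDiff b Y Y' α = 0 := by
  let f : (Fin b → ℤ) → ℤ := fun γ =>
    ∑ σ : Equiv.Perm (Fin b), (Equiv.Perm.sign σ : ℤ) * if γ ∘ σ = α + staircase b then 1 else 0
  have hf : Antisymm f := by
    intro τ γ
    simp only [f, Finset.mul_sum]
    rw [← Equiv.sum_comp (Equiv.mulLeft τ) fun σ => (Equiv.Perm.sign τ : ℤ) *
      ((Equiv.Perm.sign σ : ℤ) * if γ ∘ σ = α + staircase b then 1 else 0)]
    refine Finset.sum_congr rfl fun σ _ => ?_
    have h1 : γ ∘ (τ * σ : Equiv.Perm (Fin b)) = (γ ∘ τ) ∘ σ := rfl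
    simp only [Equiv.coe_mulLeft, h1, Equiv.Perm.sign_mul, Units.val_mul, ← mul_assoc,
      Int.units_coe_mul_self, one_mul]
  have hsum := h f hf
  simp only [f] at hsum
  rw [Finset.sum_comm, Finset.sum_comm (s := Y'), ← sub_eq_zero, ← Finset.sum_sub_distrib] at hsum
  have hterm : ∀ σ : Equiv.Perm (Fin b), ∀ w,
      swt b w ∘ σ = α + staircase b ↔
        wt b w = fun j => (α + staircase b) (σ⁻¹ j) - staircase b j := by
    intro σ w
    constructor
    · intro h
      funext j
      have := congrFun h (σ⁻¹ j)
      rw [Function.comp, show σ (σ⁻¹ j) = j from σ.apply_symm_apply j] at this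
      rw [← this]
      simp [swt]
    · intro h
      funext j
      simp [swt, h]
  simp only [hterm, ← Finset.mul_sum, ← mul_sub] at hsum
  rw [Finset.sum_eq_single 1] at hsum
  · simpa [weightDiff] using hsum
  · intro σ _ hσ
    have := hmax _ (sum_sq_lt hα (inv_ne_one.2 hσ))
    unfold weightDiff at this
    rw [this, mul_zero]
  · simp

lemma sameWeights_of_antisymm {b : ℕ} {Y Y' : Finset (List ℕ)} (hY : StepClosed b (· ∈ Y))
    (hY' : StepClosed b (· ∈ Y'))
    (h : ∀ f : (Fin b → ℤ) → ℤ, Antisymm f →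
      ∑ w ∈ Y, f (swt b w) = ∑ w ∈ Y', f (swt b w)) : SameWeights b Y Y' := by
  classical
  let S : Finset (Fin b → ℤ) := (Y ∪ Y').image (wt b)
  have hS : ∀ α, weightDiff b Y Y' α ≠ 0 → α ∈ S := by
    intro α hα
    by_contra hn
    apply hα
    have hne : ∀ w ∈ Y ∪ Y', wt b w ≠ α := fun w hw h =>
      hn (Finset.mem_image.2 ⟨w, hw, h⟩)
    unfold weightDiff
    rw [Finset.sum_eq_zero, Finset.sum_eq_zero, sub_zero]
    · intro w hw
      rw [if_neg (hne w (Finset.mem_union_right _ hw))]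
    · intro w hw
      rw [if_neg (hne w (Finset.mem_union_left _ hw))]
  have hzero : ∀ α, weightDiff b Y Y' α = 0 := by
    by_contra! hcon
    obtain ⟨α₀, hα₀⟩ := hcon
    obtain ⟨α, hα, hmax⟩ := (S.filter fun α => weightDiff b Y Y' α ≠ 0).exists_max_image
      (fun α => ∑ j, α j ^ 2) ⟨α₀, Finset.mem_filter.2 ⟨hS _ hα₀, hα₀⟩⟩
    rw [Finset.mem_filter] at hα
    have hanti : Antitone (α ∘ Tuple.sort (-α)) := by
      intro i j hij
      have := Tuple.monotone_sort (-α) hij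
      simpa using this
    apply hα.2
    rw [← weightDiff_comp hY hY' (Tuple.sort (-α))]
    apply weightDiff_eq_zero_of_antitone h hanti
    intro β hβ
    by_contra hne
    have h1 := hmax β (Finset.mem_filter.2 ⟨hS _ hne, hne⟩)
    have h2 : ∑ j, (α ∘ Tuple.sort (-α)) j ^ 2 = ∑ j, α j ^ 2 :=
      Equiv.sum_comp (Tuple.sort (-α)) fun j => α j ^ 2
    omega
  intro F
  have hexp : ∀ Z ⊆ Y ∪ Y', ∑ w ∈ Z, F (wt b w) =
      ∑ α ∈ S, F α * ∑ w ∈ Z, if wt b w = α then 1 else 0 := by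
    intro Z hZ
    simp only [Finset.mul_sum]
    rw [Finset.sum_comm]
    refine Finset.sum_congr rfl fun w hw => ?_
    simp only [mul_ite, mul_one, mul_zero]
    rw [Finset.sum_ite_eq, if_pos (Finset.mem_image_of_mem _ (hZ hw))]
  rw [hexp Y Finset.subset_union_left, hexp Y' Finset.subset_union_right]
  refine Finset.sum_congr rfl fun α _ => ?_
  rw [sub_eq_zero.1 (hzero α)]

open Classical in
lemma SameWeights.filter {b k : ℕ} (hk : 1 ≤ k) {X X' : Finset (List ℕ)}
    (h : SameWeights b X X') (hX : StepClosed b (· ∈ X)) (hX' : StepClosed b (· ∈ X'))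
    (hpos : ∀ w ∈ X, ∀ x ∈ w, 1 ≤ x) (hpos' : ∀ w ∈ X', ∀ x ∈ w, 1 ≤ x) :
    SameWeights b (X.filter fun w => ¬ HasInc k (w.filter (· ≤ b)))
      (X'.filter fun w => ¬ HasInc k (w.filter (· ≤ b))) := by
  refine sameWeights_of_antisymm (stepClosed_filter hX le_rfl) (stepClosed_filter hX' le_rfl) ?_
  intro f hf
  rw [sum_filter_not_hasInc hk hX hpos hf, sum_filter_not_hasInc hk hX' hpos' hf]
  exact h fun γ => if (Finset.univ.filter fun j : Fin b =>
    (b : ℤ) - k < (γ + staircase b) j).card < k then f (γ + staircase b) else 0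

/-- Put `x` at the left or at the right end of `w`. -/
def place {α : Type*} (s : Bool) (x : α) (w : List α) : List α :=
  if s then x :: w else w ++ [x]

lemma place_inj {α : Type*} {s : Bool} {x y : α} {w v : List α} :
    place s x w = place s y v ↔ x = y ∧ w = v := by
  cases s <;> simp [place, and_comm]

lemma exists_eq_place {α : Type*} (s : Bool) {w : List α} (h : w ≠ []) :
    ∃ x v, w = place s x v := by
  cases s
  · obtain rfl | ⟨v, x, rfl⟩ := w.eq_nil_or_concat
    · exact absurd rfl h
    · exact ⟨x, v, by simp [place]⟩
  · obtain ⟨x, v, rfl⟩ := List.exists_cons_of_ne_nil h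
    exact ⟨x, v, rfl⟩

lemma place_ne_nil {α : Type*} (s : Bool) (x : α) (w : List α) : place s x w ≠ [] := by
  cases s <;> simp [place]

lemma mem_place {α : Type*} {s : Bool} {x y : α} {w : List α} :
    y ∈ place s x w ↔ y = x ∨ y ∈ w := by
  cases s <;> simp [place, or_comm]

lemma map_place {α β : Type*} (f : α → β) (s : Bool) (x : α) (w : List α) :
    (place s x w).map f = place s (f x) (w.map f) := by
  cases s <;> simp [place]

lemma reverse_place {α : Type*} (s : Bool) (x : α) (w : List α) :
    (place s x w).reverse = place (!s) x w.reverse := by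
  cases s <;> simp [place]

lemma sublist_place {α : Type*} (s : Bool) (x : α) (w : List α) : w.Sublist (place s x w) := by
  cases s <;> simp [place]

lemma sublist_or_mem_of_sublist_place {α : Type*} {s : Bool} {x : α} {w c : List α}
    (h : c.Sublist (place s x w)) : c.Sublist w ∨ x ∈ c := by
  cases s
  · obtain ⟨a, d, rfl, ha, hd⟩ := List.sublist_append_iff.1 h
    rcases List.sublist_singleton.1 hd with rfl | rfl
    · left; simpa using ha
    · right; simp
  · cases h with
    | cons _ h => exact Or.inl h
    | cons_cons _ h => right; simp

/-- Words obtained from a word in `X` by placing a letter in `1, …, b` at one end. -/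
def placements (s : Bool) (b : ℕ) (X : Finset (List ℕ)) : Finset (List ℕ) :=
  (Finset.Icc 1 b ×ˢ X).image fun p => place s p.1 p.2

lemma place_mem_placements {s : Bool} {b x : ℕ} {X : Finset (List ℕ)} {w : List ℕ} :
    place s x w ∈ placements s b X ↔ (1 ≤ x ∧ x ≤ b) ∧ w ∈ X := by
  simp only [placements, Finset.mem_image, Finset.mem_product, Finset.mem_Icc, Prod.exists,
    place_inj]
  constructor
  · rintro ⟨x, w, h, rfl, rfl⟩; exact h
  · intro h; exact ⟨x, w, h, rfl, rfl⟩

lemma eq_place_of_mem_placements {s : Bool} {b : ℕ} {X : Finset (List ℕ)} {w : List ℕ}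
    (h : w ∈ placements s b X) : ∃ x v, w = place s x v ∧ (1 ≤ x ∧ x ≤ b) ∧ v ∈ X := by
  simp only [placements, Finset.mem_image, Finset.mem_product, Finset.mem_Icc, Prod.exists] at h
  obtain ⟨x, v, h, rfl⟩ := h
  exact ⟨x, v, rfl, h⟩

lemma Step.place {s : Bool} {i x x' : ℕ} {w w' : List ℕ}
    (h : Step i (place s x w) (place s x' w')) :
    (w = w' ∧ x = i ∧ x' = i + 1) ∨ (Step i w w' ∧ x = x') := by
  cases s
  · exact h.concat
  · exact h.cons

lemma stepClosed_placements {s : Bool} {b b' : ℕ} {X : Finset (List ℕ)}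
    (hX : StepClosed b' (· ∈ X)) (hb : b' ≤ b) : StepClosed b' (· ∈ placements s b X) := by
  intro i w w' h1 h2 hs
  have hne : w ≠ [] := by
    obtain ⟨A, B, rfl, -⟩ := hs; simp
  have hne' : w' ≠ [] := by
    obtain ⟨A, B, -, rfl, -⟩ := hs; simp
  obtain ⟨x, v, rfl⟩ := exists_eq_place s hne
  obtain ⟨x', v', rfl⟩ := exists_eq_place s hne'
  simp only [place_mem_placements]
  rcases hs.place with ⟨rfl, rfl, rfl⟩ | ⟨hs', rfl⟩
  · have : 1 ≤ x ∧ x ≤ b ↔ 1 ≤ x + 1 ∧ x + 1 ≤ b := by omega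
    rw [this]
  · have := hX i v v' h1 h2 hs'
    simp only at this
    rw [this]

lemma wt_place (b : ℕ) (s : Bool) (x : ℕ) (w : List ℕ) :
    wt b (place s x w) = wt b w + wt b [x] := by
  funext j
  cases s
  · simp [wt, place]
  · simp only [wt, place, if_true, Pi.add_apply, List.count_cons, List.count_nil]
    push_cast; ring

lemma SameWeights.placements {b b' : ℕ} {X X' : Finset (List ℕ)} (h : SameWeights b' X X')
    (s s' : Bool) : SameWeights b' (placements s b X) (placements s' b X') := by
  have key : ∀ s X, ∀ F : (Fin b' → ℤ) → ℤ, ∑ w ∈ CrystalWord.placements s b X, F (wt b' w) =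
      ∑ x ∈ Finset.Icc 1 b, ∑ w ∈ X, F (wt b' w + wt b' [x]) := by
    intro s X F
    rw [CrystalWord.placements, Finset.sum_image, Finset.sum_product]
    · simp only [wt_place]
    · rintro ⟨x, w⟩ _ ⟨y, v⟩ _ hp
      exact Prod.ext_iff.2 (place_inj.1 hp)
  intro F
  rw [key, key]
  exact Finset.sum_congr rfl fun x _ => h fun γ => F (γ + wt b' [x])

lemma SameWeights.mono {b b' : ℕ} {X X' : Finset (List ℕ)} (h : SameWeights b X X')
    (hb : b' ≤ b) : SameWeights b' X X' :=
  fun F => h fun γ => F (γ ∘ Fin.castLE hb)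

open Classical in
/-- Words whose positions are filled from the inside outwards, avoiding at each stage an increasing
subsequence of length `k` with letters at most the current bound. -/
noncomputable def fillings (k : ℕ) : List (Bool × ℕ) → Finset (List ℕ)
  | [] => {[]}
  | (s, b) :: D => (placements s b (fillings k D)).filter fun w => ¬ HasInc k (w.filter (· ≤ b))

lemma mem_fillings_cons {k : ℕ} {p : Bool × ℕ} {D : List (Bool × ℕ)} {w : List ℕ} :
    w ∈ fillings k (p :: D) ↔
      w ∈ placements p.1 p.2 (fillings k D) ∧ ¬ HasInc k (w.filter (· ≤ p.2)) := by
  classical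
  exact Finset.mem_filter

/-- The bounds of the positions, from left to right. -/
def caps : List (Bool × ℕ) → List ℕ
  | [] => []
  | (s, b) :: D => place s b (caps D)

/-- Exchange left and right. -/
def flip (D : List (Bool × ℕ)) : List (Bool × ℕ) := D.map fun p => (!p.1, p.2)

lemma caps_flip (D : List (Bool × ℕ)) : caps (flip D) = (caps D).reverse := by
  induction D with
  | nil => rfl
  | cons p D ih =>
    obtain ⟨s, b⟩ := p
    simp only [caps, flip, List.map_cons, reverse_place] at *
    rw [ih]

lemma mem_caps {D : List (Bool × ℕ)} {q : Bool × ℕ} (h : q ∈ D) : q.2 ∈ caps D := by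
  induction D with
  | nil => simp at h
  | cons p D ih =>
    simp only [caps, mem_place]
    rcases List.mem_cons.1 h with rfl | h
    · exact Or.inl rfl
    · exact Or.inr (ih h)

lemma of_mem_caps {D : List (Bool × ℕ)} {x : ℕ} (h : x ∈ caps D) : ∃ q ∈ D, q.2 = x := by
  induction D with
  | nil => simp [caps] at h
  | cons p D ih =>
    simp only [caps, mem_place] at h
    rcases h with rfl | h
    · exact ⟨p, by simp, rfl⟩
    · obtain ⟨q, hq, h⟩ := ih h
      exact ⟨q, by simp [hq], h⟩

lemma stepClosed_fillings (k : ℕ) {b : ℕ} {D : List (Bool × ℕ)} (h : ∀ q ∈ D, b ≤ q.2) :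
    StepClosed b (· ∈ fillings k D) := by
  induction D with
  | nil =>
    intro i w w' _ _ hs
    obtain ⟨A, B, rfl, rfl, -, -⟩ := hs
    simp [fillings]
  | cons p D ih =>
    obtain ⟨s, c⟩ := p
    simp only [List.forall_mem_cons] at h
    exact stepClosed_filter (stepClosed_placements (ih h.2) h.1) h.1

lemma one_le_of_mem_fillings {k : ℕ} {D : List (Bool × ℕ)} : ∀ w ∈ fillings k D, ∀ x ∈ w,
    1 ≤ x := by
  induction D with
  | nil => simp [fillings]
  | cons p D ih =>
    intro w hw x hx
    obtain ⟨y, v, rfl, h1, h2⟩ := eq_place_of_mem_placements (mem_fillings_cons.1 hw).1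
    rcases mem_place.1 hx with rfl | hx
    · exact h1.1
    · exact ih v h2 x hx

lemma one_le_of_mem_placements {k b : ℕ} {s : Bool} {D : List (Bool × ℕ)} :
    ∀ w ∈ placements s b (fillings k D), ∀ x ∈ w, 1 ≤ x := by
  intro w hw x hx
  obtain ⟨y, v, rfl, h1, h2⟩ := eq_place_of_mem_placements hw
  rcases mem_place.1 hx with rfl | hx
  · exact h1.1
  · exact one_le_of_mem_fillings v h2 x hx

lemma sameWeights_fillings_flip {k : ℕ} (hk : 1 ≤ k) {D : List (Bool × ℕ)} {b : ℕ}
    (hD : D.Pairwise fun p q => p.2 ≤ q.2) (hb : ∀ q ∈ D, b ≤ q.2) :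
    SameWeights b (fillings k D) (fillings k (flip D)) := by
  induction D generalizing b with
  | nil => intro F; rfl
  | cons p D ih =>
    obtain ⟨s, c⟩ := p
    rw [List.pairwise_cons] at hD
    simp only [List.forall_mem_cons] at hb
    have hD' : ∀ q ∈ flip D, c ≤ q.2 := by
      intro q hq
      obtain ⟨q', hq', rfl⟩ := List.mem_map.1 hq
      exact hD.1 q' hq'
    refine SameWeights.mono (SameWeights.filter hk ((ih hD.2 hD.1).placements s (!s)) ?_ ?_
      one_le_of_mem_placements one_le_of_mem_placements) hb.1
    · exact stepClosed_placements (stepClosed_fillings k hD.1) le_rfl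
    · exact stepClosed_placements (stepClosed_fillings k hD') le_rfl

lemma card_fillings_flip {k : ℕ} (hk : 1 ≤ k) {D : List (Bool × ℕ)}
    (hD : D.Pairwise fun p q => p.2 ≤ q.2) :
    (fillings k D).card = (fillings k (flip D)).card := by
  have := sameWeights_fillings_flip hk (b := 0) hD (by simp) fun _ => 1
  simpa using this

/-- The word `u` of pairs (bound, letter) has a subword of length `k` whose letters are pairwise
related by `r` and do not exceed the bounds of any of its positions. -/
def HasChain (r : ℕ → ℕ → Prop) (k : ℕ) (u : List (ℕ × ℕ)) : Prop :=
  ∃ c : List (ℕ × ℕ), c.Sublist u ∧ c.length = k ∧ c.Pairwise (fun p q => r p.2 q.2) ∧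
    ∀ p ∈ c, ∀ q ∈ c, p.2 ≤ q.1

/-- The words with bounds `H` and without chains of length `k`. -/
def ChainFree (r : ℕ → ℕ → Prop) (k : ℕ) (H : List ℕ) : Set (List (ℕ × ℕ)) :=
  {u | u.map Prod.fst = H ∧ (∀ q ∈ u, 1 ≤ q.2 ∧ q.2 ≤ q.1) ∧ ¬ HasChain r k u}

lemma hasChain_reverse (k : ℕ) (u : List (ℕ × ℕ)) :
    HasChain (· < ·) k u.reverse ↔ HasChain (· > ·) k u := by
  constructor
  · rintro ⟨c, hc, hk, hp, hb⟩
    exact ⟨c.reverse, by simpa using hc.reverse, by simpa using hk, by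
      rw [List.pairwise_reverse]; exact hp, by simpa using hb⟩
  · rintro ⟨c, hc, hk, hp, hb⟩
    exact ⟨c.reverse, hc.reverse, by simpa using hk, by
      rw [List.pairwise_reverse]; exact hp, by simpa using hb⟩

lemma hasChain_place {k b x : ℕ} {s : Bool} {u : List (ℕ × ℕ)} (hu : ∀ q ∈ u, b ≤ q.1) :
    HasChain (· < ·) k (place s (b, x) u) ↔ HasChain (· < ·) k u ∨
      HasInc k (((place s (b, x) u).map Prod.snd).filter (· ≤ b)) := by
  constructor
  · rintro ⟨c, hc, hk, hp, hb⟩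
    rcases sublist_or_mem_of_sublist_place hc with h | h
    · exact Or.inl ⟨c, h, hk, hp, hb⟩
    · refine Or.inr ⟨c.map Prod.snd, ?_, by simpa using hk, List.pairwise_map.2 hp⟩
      have := (hc.map Prod.snd).filter (· ≤ b)
      rwa [List.filter_eq_self.2] at this
      intro y hy
      obtain ⟨p, hp, rfl⟩ := List.mem_map.1 hy
      simpa using hb p hp _ h
  · rintro (⟨c, hc, h⟩ | ⟨c, hc, hk, hp⟩)
    · exact ⟨c, hc.trans (sublist_place _ _ _), h⟩
    · rw [List.filter_map] at hc
      obtain ⟨d, hd, rfl⟩ := List.sublist_map_iff.1 hc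
      refine ⟨d, hd.trans List.filter_sublist, by simpa using hk, List.pairwise_map.1 hp, ?_⟩
      intro p hp q hq
      have h1 := (List.mem_filter.1 (hd.subset hp)).2
      have h2 := (List.mem_filter.1 (hd.subset hq)).1
      simp only [Function.comp, decide_eq_true_eq] at h1
      rcases mem_place.1 h2 with rfl | h2
      · exact h1
      · exact h1.trans (hu q h2)

lemma map_snd_mem_fillings {k : ℕ} {D : List (Bool × ℕ)} (hk : 1 ≤ k)
    (hD : D.Pairwise fun p q => p.2 ≤ q.2) {u : List (ℕ × ℕ)} (hu : u.map Prod.fst = caps D) :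
    u.map Prod.snd ∈ fillings k D ↔
      (∀ q ∈ u, 1 ≤ q.2 ∧ q.2 ≤ q.1) ∧ ¬ HasChain (· < ·) k u := by
  induction D generalizing u with
  | nil =>
    have : u = [] := by simpa [caps] using hu
    subst this
    simp only [List.map_nil, fillings, Finset.mem_singleton, List.not_mem_nil, false_imp_iff,
      implies_true, true_and, true_iff]
    rintro ⟨c, hc, rfl, -⟩
    simp at hc
    simp [hc] at hk
  | cons p D ih =>
    obtain ⟨s, b⟩ := p
    rw [List.pairwise_cons] at hD
    simp only [caps] at hu
    have hne : u ≠ [] := by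
      rintro rfl
      exact place_ne_nil _ _ _ hu.symm
    obtain ⟨⟨b', x⟩, v, rfl⟩ := exists_eq_place s hne
    rw [map_place, place_inj] at hu
    obtain ⟨rfl, hv⟩ := hu
    have hvb : ∀ q ∈ v, b' ≤ q.1 := by
      intro q hq
      obtain ⟨p, hp, h⟩ := of_mem_caps (hv ▸ List.mem_map_of_mem (f := Prod.fst) hq)
      exact h ▸ hD.1 p hp
    rw [hasChain_place hvb, mem_fillings_cons, map_place, place_mem_placements,
      ih hD.2 hv]
    simp only [mem_place, forall_eq_or_imp]
    tauto

lemma nonempty_chainFree_equiv_fillings {k : ℕ} {D : List (Bool × ℕ)} (hk : 1 ≤ k)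
    (hD : D.Pairwise fun p q => p.2 ≤ q.2) :
    Nonempty (ChainFree (· < ·) k (caps D) ≃ fillings k D) := by
  refine ⟨Equiv.ofBijective
    (fun u => ⟨u.1.map Prod.snd, (map_snd_mem_fillings hk hD u.2.1).2 u.2.2⟩) ⟨?_, ?_⟩⟩
  · rintro ⟨u, hu⟩ ⟨v, hv⟩ h
    simp only [Subtype.mk.injEq] at h
    rw [Subtype.mk.injEq, ← List.zip_unzip u, ← List.zip_unzip v, List.unzip_eq_map,
      List.unzip_eq_map, h, hu.1, hv.1]
  · rintro ⟨w, hw⟩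
    have hlen : ∀ (D : List (Bool × ℕ)), ∀ w ∈ fillings k D, w.length = (caps D).length := by
      intro D
      induction D with
      | nil => simp [fillings, caps]
      | cons p D ih =>
        intro w hw
        obtain ⟨y, v, rfl, -, h2⟩ := eq_place_of_mem_placements (mem_fillings_cons.1 hw).1
        have := ih v h2
        obtain ⟨s, b⟩ := p
        cases s <;> simpa [caps, place] using this
    have h1 : ((caps D).zip w).map Prod.fst = caps D := List.map_fst_zip (hlen D w hw).ge
    have h2 : ((caps D).zip w).map Prod.snd = w := List.map_snd_zip (hlen D w hw).le
    refine ⟨⟨(caps D).zip w, h1, ?_⟩, Subtype.ext h2⟩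
    rw [← map_snd_mem_fillings hk hD h1, h2]
    exact hw

/-- No entry is smaller than both an earlier and a later entry. -/
def Unimodal (H : List ℕ) : Prop := ∀ a b c, [a, b, c].Sublist H → min a c ≤ b

lemma Unimodal.exists_eq_place {H : List ℕ} (hH : Unimodal H) (hne : H ≠ []) :
    ∃ s b H', H = place s b H' ∧ ∀ x ∈ H', b ≤ x := by
  obtain ⟨x, t, rfl⟩ := List.exists_cons_of_ne_nil hne
  obtain rfl | ⟨m, y, rfl⟩ := t.eq_nil_or_concat
  · exact ⟨true, x, [], rfl, by simp⟩
  rw [List.concat_eq_append] at *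
  have hm : ∀ z ∈ m, min x y ≤ z := fun z hz =>
    hH x z y (((List.singleton_sublist.2 hz).append (List.Sublist.refl [y])).cons_cons x)
  rcases le_total x y with h | h
  · refine ⟨true, x, m ++ [y], rfl, fun z hz => ?_⟩
    rcases List.mem_append.1 hz with hz | hz
    · simpa [h] using hm z hz
    · simpa [List.mem_singleton.1 hz] using h
  · refine ⟨false, y, x :: m, rfl, fun z hz => ?_⟩
    rcases List.mem_cons.1 hz with rfl | hz
    · exact h
    · simpa [h] using hm z hz

lemma Unimodal.exists_caps : ∀ {n : ℕ} {H : List ℕ}, H.length = n → Unimodal H →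
    ∃ D : List (Bool × ℕ), caps D = H ∧ D.Pairwise fun p q => p.2 ≤ q.2 := by
  intro n
  induction n with
  | zero =>
    intro H hn _
    exact ⟨[], by simpa [caps] using (List.length_eq_zero_iff.1 hn).symm, by simp⟩
  | succ n ih =>
    intro H hn hH
    obtain ⟨s, b, H', rfl, hb⟩ := hH.exists_eq_place (by rintro rfl; simp at hn)
    obtain ⟨D, rfl, hD⟩ := ih (H := H') (by cases s <;> simpa [place] using hn)
      fun a c d h => hH a c d (h.trans (sublist_place _ _ _))
    exact ⟨(s, b) :: D, rfl, List.pairwise_cons.2 ⟨fun q hq => hb _ (mem_caps hq), hD⟩⟩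

/-- For unimodal bounds, avoiding increasing chains is equinumerous with avoiding decreasing
chains. -/
theorem Unimodal.nonempty_equiv {k : ℕ} (hk : 1 ≤ k) {H : List ℕ} (hH : Unimodal H) :
    Nonempty (ChainFree (· < ·) k H ≃ ChainFree (· > ·) k H) := by
  obtain ⟨D, rfl, hD⟩ := hH.exists_caps rfl
  have hD' : (flip D).Pairwise fun p q => p.2 ≤ q.2 := by
    rw [flip, List.pairwise_map]; exact hD
  obtain ⟨e₁⟩ := nonempty_chainFree_equiv_fillings hk hD
  obtain ⟨e₂⟩ := nonempty_chainFree_equiv_fillings hk hD'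
  rw [caps_flip] at e₂
  have hmem : ∀ u, u ∈ ChainFree (· > ·) k (caps D) ↔
      u.reverse ∈ ChainFree (· < ·) k (caps D).reverse := by
    intro u
    simp [ChainFree, hasChain_reverse]
  refine ⟨e₁.trans ((Finset.equivOfCardEq (card_fillings_flip hk hD)).trans
    (e₂.symm.trans (Equiv.subtypeEquiv ⟨List.reverse, List.reverse, List.reverse_reverse,
      List.reverse_reverse⟩ fun u => ?_)))⟩
  simp [hmem]

end CrystalWord

namespace PartitionPattern

open CrystalWord

/-- The maximum of the first `j` values of `p`. -/
def prefixMax (p : ℕ → ℕ) (j : ℕ) : ℕ := ((List.range j).map p).foldr max 0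

lemma prefixMax_succ (p : ℕ → ℕ) (j : ℕ) : prefixMax p (j + 1) = max (prefixMax p j) (p j) := by
  have : ∀ (l : List ℕ) (a : ℕ), l.foldr max a = max (l.foldr max 0) a := by
    intro l a
    induction l with
    | nil => simp
    | cons x l ih => simp only [List.foldr_cons]; rw [ih, max_assoc]
  simp only [prefixMax, List.range_succ, List.map_append, List.foldr_append]
  rw [this]
  simp

lemma prefixMax_mono (p : ℕ → ℕ) : Monotone (prefixMax p) :=
  monotone_nat_of_le_succ fun j => by rw [prefixMax_succ]; exact le_max_left _ _

lemma le_prefixMax {p : ℕ → ℕ} {i j : ℕ} (h : i < j) : p i ≤ prefixMax p j := by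
  refine le_trans ?_ (prefixMax_mono p (Nat.succ_le_of_lt h))
  rw [Nat.succ_eq_add_one, prefixMax_succ]
  exact le_max_right _ _

/-- The first `n` values of `p` form the canonical sequence of a partition. -/
def Canonical (n : ℕ) (p : ℕ → ℕ) : Prop := ∀ j < n, 1 ≤ p j ∧ p j ≤ prefixMax p j + 1

lemma isCanonicalSeq_map_range {n : ℕ} {p : ℕ → ℕ} :
    IsCanonicalSeq ((List.range n).map p) ↔ Canonical n p := by
  have key : ∀ j, j < n → (((List.range n).map p).take j).foldr max 0 = prefixMax p j := by
    intro j hj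
    rw [← List.map_take, List.take_range, min_eq_left hj.le, prefixMax]
  constructor
  · intro h j hj
    have := h j (by simpa using hj)
    rw [key j hj] at this
    simpa using this
  · intro h j hj
    have hj' : j < n := by simpa using hj
    rw [key j hj']
    simpa using h j hj'

/-- The values of `p` at the positions in `L` contain the pattern `τ` with all letters
above `v`. -/
def ContainsAbove (τ : List ℕ) (p : ℕ → ℕ) (v : ℕ) (L : List ℕ) : Prop :=
  ∃ g : ℕ → ℕ, StrictMonoOn g {x | x ∈ τ} ∧ (∀ x ∈ τ, v < g x) ∧ (τ.map g).Sublist (L.map p)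

lemma ContainsAbove.mono {τ : List ℕ} {p : ℕ → ℕ} {v v' : ℕ} {L L' : List ℕ}
    (h : ContainsAbove τ p v L) (hv : v' ≤ v) (hL : L.Sublist L') : ContainsAbove τ p v' L' := by
  obtain ⟨g, h1, h2, h3⟩ := h
  exact ⟨g, h1, fun x hx => hv.trans_lt (h2 x hx), h3.trans (hL.map p)⟩

lemma ContainsAbove.congr {τ : List ℕ} {p p' : ℕ → ℕ} {v : ℕ} {L : List ℕ}
    (h : ContainsAbove τ p v L) (hp : ∀ l ∈ L, p' l = p l ∨ (p l ≤ v ∧ p' l ≤ v)) :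
    ContainsAbove τ p' v L := by
  obtain ⟨g, h1, h2, h3⟩ := h
  refine ⟨g, h1, h2, ?_⟩
  have h4 := h3.filter (v < ·)
  rw [List.filter_eq_self.2 (by simpa using h2)] at h4
  have h5 : (L.map p).filter (v < ·) = (L.map p').filter (v < ·) := by
    clear h3 h4
    induction L with
    | nil => rfl
    | cons l L ih =>
      rw [List.forall_mem_cons] at hp
      simp only [List.map_cons, List.filter_cons, ih hp.2]
      rcases hp.1 with h | h
      · rw [h]
      · simp [not_lt.2 h.1, not_lt.2 h.2]
  exact (h5 ▸ h4).trans List.filter_sublist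

open Classical in
/-- The largest letter occurring before position `j` above which the positions in `side j`
contain `τ`. -/
noncomputable def height (τ : List ℕ) (side : ℕ → List ℕ) (p : ℕ → ℕ) (j : ℕ) : ℕ :=
  Nat.findGreatest (fun v => ContainsAbove τ p v (side j)) (prefixMax p j)

lemma le_height {τ : List ℕ} {side : ℕ → List ℕ} {p : ℕ → ℕ} {j v : ℕ} (hv : 1 ≤ v) :
    v ≤ height τ side p j ↔ v ≤ prefixMax p j ∧ ContainsAbove τ p v (side j) := by
  classical
  constructor
  · intro h
    have h0 : height τ side p j ≠ 0 := by omega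
    refine ⟨h.trans (Nat.findGreatest_le _), ?_⟩
    exact (Nat.findGreatest_of_ne_zero (P := fun v => ContainsAbove τ p v (side j))
      rfl h0).mono h (List.Sublist.refl _)
  · rintro ⟨h1, h2⟩
    exact Nat.le_findGreatest h1 h2

lemma height_le {τ : List ℕ} {side : ℕ → List ℕ} {p : ℕ → ℕ} {j : ℕ} :
    height τ side p j ≤ prefixMax p j := by
  classical
  exact Nat.findGreatest_le _

/-- A choice, for each position, of the positions on one of its sides. -/
structure IsSide (n : ℕ) (side : ℕ → List ℕ) : Prop where
  lt : ∀ j < n, ∀ l ∈ side j, l < n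
  sublist : ∀ j < n, ∀ l ∈ side j, (side l).Sublist (side j)
  length_lt : ∀ j < n, ∀ l ∈ side j, (side l).length < (side j).length
  between : ∀ i j l, i < j → j < l → l < n → (side i).Sublist (side j) ∨ (side l).Sublist (side j)

lemma isSide_range (n : ℕ) : IsSide n List.range where
  lt j hj l hl := (List.mem_range.1 hl).trans hj
  sublist j hj l hl := List.range_sublist.2 (List.mem_range.1 hl).le
  length_lt j hj l hl := by simpa using hl
  between i j l hij hjl hl := Or.inl (List.range_sublist.2 hij.le)

/-- The positions below `n` and after `j`. -/
def after (n j : ℕ) : List ℕ := (List.range n).drop (j + 1)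

lemma mem_after {n j l : ℕ} : l ∈ after n j ↔ j < l ∧ l < n := by
  simp only [after, List.range_eq_range', List.drop_range', List.mem_range']
  constructor
  · rintro ⟨i, hi, rfl⟩; omega
  · rintro ⟨h1, h2⟩; exact ⟨l - (j + 1), by omega, by omega⟩

lemma after_sublist {n i j : ℕ} (h : i ≤ j) : (after n j).Sublist (after n i) :=
  List.drop_sublist_drop_left _ (by omega)

lemma isSide_after (n : ℕ) : IsSide n (after n) where
  lt j hj l hl := (mem_after.1 hl).2
  sublist j hj l hl := after_sublist (mem_after.1 hl).1.le
  length_lt j hj l hl := by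
    have := mem_after.1 hl
    simp only [after, List.length_drop, List.length_range]
    omega
  between i j l hij hjl hl := Or.inr (after_sublist hjl.le)

lemma min_height_le {n : ℕ} {τ : List ℕ} {side : ℕ → List ℕ} (hs : IsSide n side) (p : ℕ → ℕ)
    {i j l : ℕ} (hij : i < j) (hjl : j < l) (hl : l < n) :
    min (height τ side p i) (height τ side p l) ≤ height τ side p j := by
  set v := min (height τ side p i) (height τ side p l)
  rcases Nat.eq_zero_or_pos v with h | h
  · omega
  have h1 := (le_height h).1 (min_le_left (height τ side p i) (height τ side p l))
  have h2 := (le_height h).1 (min_le_right (height τ side p i) (height τ side p l))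
  refine (le_height h).2 ⟨h1.1.trans (prefixMax_mono p hij.le), ?_⟩
  rcases hs.between i j l hij hjl hl with hb | hb
  · exact h1.2.mono le_rfl hb
  · exact h2.2.mono le_rfl hb

/-- `p'` arises from `p` by changing letters that are at most the height at their position to
other such letters. -/
def Related (n : ℕ) (τ : List ℕ) (side : ℕ → List ℕ) (p p' : ℕ → ℕ) : Prop :=
  ∀ j < n, (p j ≤ height τ side p j ∧ 1 ≤ p' j ∧ p' j ≤ height τ side p j) ∨
    (height τ side p j < p j ∧ p' j = p j)

section
variable {n : ℕ} {τ : List ℕ} {side : ℕ → List ℕ} {p p' p'' : ℕ → ℕ}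

lemma Related.prefixMax_eq (h : Related n τ side p p') {j : ℕ} (hj : j ≤ n) :
    prefixMax p' j = prefixMax p j := by
  induction j with
  | zero => rfl
  | succ j ih =>
    have := height_le (τ := τ) (side := side) (p := p) (j := j)
    rw [prefixMax_succ, prefixMax_succ, ih (by omega)]
    rcases h j hj with h | h <;> omega

lemma Related.canonical (h : Related n τ side p p') (hp : Canonical n p) : Canonical n p' := by
  intro j hj
  have := height_le (τ := τ) (side := side) (p := p) (j := j)
  have := hp j hj
  rw [h.prefixMax_eq hj.le]
  rcases h j hj with h | h <;> omega

lemma Related.containsAbove_iff (hs : IsSide n side) (h : Related n τ side p p')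
    {v : ℕ} (hv : 1 ≤ v) : ∀ (m : ℕ) (j : ℕ), j < n → (side j).length = m →
      (ContainsAbove τ p v (side j) ↔ ContainsAbove τ p' v (side j)) := by
  intro m
  induction m using Nat.strong_induction_on with
  | _ m ih =>
    intro j hj hm
    by_cases hex : ∃ l ∈ side j, ContainsAbove τ p v (side l)
    · obtain ⟨l, hl, hc⟩ := hex
      have hlen := hs.length_lt j hj l hl
      have hc' := (ih _ (by omega) l (hs.lt j hj l hl) rfl).1 hc
      exact iff_of_true (hc.mono le_rfl (hs.sublist j hj l hl))
        (hc'.mono le_rfl (hs.sublist j hj l hl))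
    · push Not at hex
      have hlow : ∀ l ∈ side j, p' l = p l ∨ (p l ≤ v ∧ p' l ≤ v) := by
        intro l hl
        have hlt : height τ side p l < v := by
          by_contra! hcon
          exact hex l hl ((le_height hv).1 hcon).2
        rcases h l (hs.lt j hj l hl) with h | h
        · right; omega
        · exact Or.inl h.2
      exact ⟨fun hc => hc.congr hlow, fun hc => hc.congr fun l hl =>
        (hlow l hl).imp Eq.symm And.symm⟩

lemma Related.height_eq (hs : IsSide n side) (h : Related n τ side p p') {j : ℕ} (hj : j < n) :
    height τ side p' j = height τ side p j := by
  have key : ∀ v, 1 ≤ v → (v ≤ height τ side p' j ↔ v ≤ height τ side p j) := by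
    intro v hv
    rw [le_height hv, le_height hv, h.prefixMax_eq hj.le]
    exact and_congr_right fun _ => (h.containsAbove_iff hs hv _ j hj rfl).symm
  apply le_antisymm
  · rcases Nat.eq_zero_or_pos (height τ side p' j) with h0 | h0
    · omega
    · exact (key _ h0).1 le_rfl
  · rcases Nat.eq_zero_or_pos (height τ side p j) with h0 | h0
    · omega
    · exact (key _ h0).2 le_rfl

lemma Related.symm (hs : IsSide n side) (hp : Canonical n p) (h : Related n τ side p p') :
    Related n τ side p' p := by
  intro j hj
  have := hp j hj
  rw [h.height_eq hs hj]
  rcases h j hj with h | h <;> omega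

end

/-- Each letter of `p` together with the height at its position. -/
noncomputable def annotate (n : ℕ) (τ : List ℕ) (side : ℕ → List ℕ) (p : ℕ → ℕ) :
    List (ℕ × ℕ) :=
  (List.range n).map fun j => (height τ side p j, p j)

/-- The letters of `p` that are at most the height at their position, with these heights. -/
noncomputable def lowPart (n : ℕ) (τ : List ℕ) (side : ℕ → List ℕ) (p : ℕ → ℕ) :
    List (ℕ × ℕ) :=
  (annotate n τ side p).filter fun q => q.2 ≤ q.1

lemma hasChain_lowPart {n : ℕ} {τ : List ℕ} {side : ℕ → List ℕ} {p : ℕ → ℕ}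
    {r : ℕ → ℕ → Prop} {k : ℕ} :
    HasChain r k (lowPart n τ side p) ↔ HasChain r k (annotate n τ side p) := by
  constructor
  · rintro ⟨c, hc, h⟩
    exact ⟨c, hc.trans List.filter_sublist, h⟩
  · rintro ⟨c, hc, hk, hr, hb⟩
    refine ⟨c, ?_, hk, hr, hb⟩
    have := hc.filter fun q => q.2 ≤ q.1
    rwa [List.filter_eq_self.2 (fun q hq => by simpa using hb q hq q hq)] at this

lemma unimodal_lowPart {n : ℕ} (τ : List ℕ) {side : ℕ → List ℕ} (hs : IsSide n side)
    (p : ℕ → ℕ) : Unimodal ((lowPart n τ side p).map Prod.fst) := by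
  intro a b c h
  have h1 : [a, b, c].Sublist ((List.range n).map (height τ side p)) := by
    refine h.trans ?_
    have := (List.filter_sublist (l := annotate n τ side p)
      (p := fun q => q.2 ≤ q.1)).map Prod.fst
    simpa [annotate, lowPart, Function.comp_def] using this
  obtain ⟨js, hjs, he⟩ := List.sublist_map_iff.1 h1
  obtain ⟨i, j, l, rfl⟩ : ∃ i j l, js = [i, j, l] := by
    have hlen := congrArg List.length he
    simp only [List.length_cons, List.length_nil, List.length_map] at hlen
    exact List.length_eq_three.1 hlen.symm
  have hp := List.pairwise_lt_range.sublist hjs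
  have hl : l < n := List.mem_range.1 (hjs.subset (by simp))
  simp only [List.map_cons, List.map_nil, List.cons.injEq] at he
  obtain ⟨rfl, rfl, rfl, -⟩ := he
  simp only [List.pairwise_cons, List.mem_cons, List.not_mem_nil, or_false] at hp
  exact min_height_le hs p (hp.1 j (by simp)) (hp.2.1 l rfl) hl

lemma exists_replace {L : List ℕ} (hL : L.Nodup) (h p : ℕ → ℕ) {u : List (ℕ × ℕ)}
    (hu : u.map Prod.fst =
      ((L.map fun j => (h j, p j)).filter fun q => q.2 ≤ q.1).map Prod.fst)
    (hu' : ∀ q ∈ u, 1 ≤ q.2 ∧ q.2 ≤ q.1) :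
    ∃ p' : ℕ → ℕ, (∀ j ∈ L, (p j ≤ h j ∧ 1 ≤ p' j ∧ p' j ≤ h j) ∨ (h j < p j ∧ p' j = p j)) ∧
      ((L.map fun j => (h j, p' j)).filter fun q => q.2 ≤ q.1) = u := by
  induction L generalizing u with
  | nil =>
    have : u = [] := by simpa using hu
    exact ⟨p, by simp, by simp [this]⟩
  | cons i L ih =>
    rw [List.nodup_cons] at hL
    by_cases hi : p i ≤ h i
    · simp only [List.map_cons, List.filter_cons, hi, decide_true, if_true] at hu
      obtain ⟨⟨b, x⟩, u, rfl⟩ := List.exists_cons_of_ne_nil (l := u) (by rintro rfl; simp at hu)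
      simp only [List.map_cons, List.cons.injEq] at hu
      obtain ⟨rfl, hu⟩ := hu
      rw [List.forall_mem_cons] at hu'
      obtain ⟨p', h1, h2⟩ := ih hL.2 hu hu'.2
      have hne : ∀ j ∈ L, Function.update p' i x j = p' j := fun j hj =>
        Function.update_of_ne (by rintro rfl; exact hL.1 hj) _ _
      refine ⟨Function.update p' i x, ?_, ?_⟩
      · rw [List.forall_mem_cons]
        refine ⟨Or.inl ⟨hi, by simpa using hu'.1⟩, fun j hj => ?_⟩
        rw [hne j hj]
        exact h1 j hj
      · have hm : (L.map fun j => (h j, Function.update p' i x j)) =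
            L.map fun j => (h j, p' j) :=
          List.map_congr_left fun j hj => by rw [hne j hj]
        rw [List.map_cons, hm, List.filter_cons, h2, Function.update_self]
        simp [hu'.1.2]
    · simp only [List.map_cons, List.filter_cons, hi, decide_false] at hu
      obtain ⟨p', h1, h2⟩ := ih hL.2 (by simpa using hu) hu'
      have hne : ∀ j ∈ L, Function.update p' i (p i) j = p' j := fun j hj =>
        Function.update_of_ne (by rintro rfl; exact hL.1 hj) _ _
      refine ⟨Function.update p' i (p i), ?_, ?_⟩
      · rw [List.forall_mem_cons]
        refine ⟨Or.inr ⟨not_le.1 hi, by simp⟩, fun j hj => ?_⟩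
        rw [hne j hj]
        exact h1 j hj
      · have hm : (L.map fun j => (h j, Function.update p' i (p i) j)) =
            L.map fun j => (h j, p' j) :=
          List.map_congr_left fun j hj => by rw [hne j hj]
        rw [List.map_cons, hm, List.filter_cons, h2, Function.update_self]
        simp [hi]

lemma eq_of_filter_eq {L : List ℕ} {h p₁ p₂ : ℕ → ℕ}
    (hp : ∀ j ∈ L, (p₁ j ≤ h j ∧ p₂ j ≤ h j) ∨ (h j < p₁ j ∧ p₁ j = p₂ j))
    (he : ((L.map fun j => (h j, p₁ j)).filter fun q => q.2 ≤ q.1) =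
      (L.map fun j => (h j, p₂ j)).filter fun q => q.2 ≤ q.1) : ∀ j ∈ L, p₁ j = p₂ j := by
  induction L with
  | nil => simp
  | cons i L ih =>
    rw [List.forall_mem_cons] at hp ⊢
    rcases hp.1 with ⟨h1, h2⟩ | ⟨h1, h2⟩
    · simp only [List.map_cons, List.filter_cons, h1, h2, decide_true, if_true,
        List.cons.injEq, Prod.mk.injEq, true_and] at he
      exact ⟨he.1, ih hp.2 he.2⟩
    · refine ⟨h2, ih hp.2 ?_⟩
      simp only [List.map_cons, List.filter_cons, ← h2, not_le.2 h1, decide_false] at he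
      simpa using he

/-- The letters of `π` as a function of the position. -/
def letter (π : List ℕ) (j : ℕ) : ℕ := π.getD j 0

lemma map_letter_range (π : List ℕ) : (List.range π.length).map (letter π) = π := by
  apply List.ext_getElem
  · simp
  · intro i h1 h2
    simp [letter, h2]

lemma letter_map_range {n j : ℕ} (p : ℕ → ℕ) (hj : j < n) :
    letter ((List.range n).map p) j = p j := by
  simp [letter, hj]

section
variable {n : ℕ} {τ : List ℕ} {side : ℕ → List ℕ} {p p' p₁ p₂ : ℕ → ℕ}

lemma Related.lowPart_eq (hs : IsSide n side) (h : Related n τ side p p') :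
    lowPart n τ side p' =
      ((List.range n).map fun j => (height τ side p j, p' j)).filter fun q => q.2 ≤ q.1 := by
  unfold lowPart annotate
  congr 1
  exact List.map_congr_left fun j hj => by rw [h.height_eq hs (List.mem_range.1 hj)]

lemma Related.map_fst_lowPart (hs : IsSide n side) (h : Related n τ side p p') :
    (lowPart n τ side p').map Prod.fst = (lowPart n τ side p).map Prod.fst := by
  rw [h.lowPart_eq hs]
  unfold lowPart annotate
  have : ∀ L : List ℕ, (∀ j ∈ L, j < n) →
      ((L.map fun j => (height τ side p j, p' j)).filter fun q => q.2 ≤ q.1).map Prod.fst =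
      ((L.map fun j => (height τ side p j, p j)).filter fun q => q.2 ≤ q.1).map Prod.fst := by
    intro L hL
    induction L with
    | nil => rfl
    | cons i L ih =>
      rw [List.forall_mem_cons] at hL
      have ih := ih hL.2
      simp only [List.map_cons, List.filter_cons]
      rcases h i hL.1 with h | h
      · simp only [h.1, h.2.2, decide_true, if_true, List.map_cons, ih]
      · simp only [h.2, not_le.2 h.1, decide_false]
        simpa using ih
  exact this _ fun j hj => List.mem_range.1 hj

lemma exists_related (hs : IsSide n side) {u : List (ℕ × ℕ)}
    (hu : u.map Prod.fst = (lowPart n τ side p).map Prod.fst)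
    (hu' : ∀ q ∈ u, 1 ≤ q.2 ∧ q.2 ≤ q.1) :
    ∃ π : List ℕ, π.length = n ∧ Related n τ side p (letter π) ∧
      lowPart n τ side (letter π) = u := by
  obtain ⟨p', h1, h2⟩ := exists_replace List.nodup_range (height τ side p) p hu hu'
  have hrel : Related n τ side p (letter ((List.range n).map p')) := by
    intro j hj
    rw [letter_map_range p' hj]
    exact h1 j (List.mem_range.2 hj)
  refine ⟨(List.range n).map p', by simp, hrel, ?_⟩
  rw [hrel.lowPart_eq hs, ← h2]
  congr 1
  exact List.map_congr_left fun j hj => by rw [letter_map_range p' (List.mem_range.1 hj)]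

lemma Related.eq_of_lowPart_eq (hs : IsSide n side) {π₁ π₂ : List ℕ} (hl₁ : π₁.length = n)
    (hl₂ : π₂.length = n) (h₁ : Related n τ side p (letter π₁))
    (h₂ : Related n τ side p (letter π₂))
    (he : lowPart n τ side (letter π₁) = lowPart n τ side (letter π₂)) : π₁ = π₂ := by
  rw [h₁.lowPart_eq hs, h₂.lowPart_eq hs] at he
  rw [← map_letter_range π₁, ← map_letter_range π₂, hl₁, hl₂]
  refine List.map_congr_left (eq_of_filter_eq (h := height τ side p) (fun j hj => ?_) he)
  have hj := List.mem_range.1 hj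
  rcases h₁ j hj with h | h <;> rcases h₂ j hj with h' | h' <;> omega

end

/-- The canonical sequences of length `n` without chains of length `k`. -/
def canonicalChainFree (n : ℕ) (τ : List ℕ) (side : ℕ → List ℕ) (r : ℕ → ℕ → Prop) (k : ℕ) :
    Set (List ℕ) :=
  {π | π.length = n ∧ IsCanonicalSeq π ∧ ¬ HasChain r k (annotate n τ side (letter π))}

lemma canonical_letter {n : ℕ} {π : List ℕ} (hn : π.length = n) :
    IsCanonicalSeq π ↔ Canonical n (letter π) := by
  rw [← isCanonicalSeq_map_range, ← hn, map_letter_range]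

lemma lowPart_mem_chainFree {n k : ℕ} {τ : List ℕ} {side : ℕ → List ℕ} {r : ℕ → ℕ → Prop}
    {π : List ℕ} (h : π ∈ canonicalChainFree n τ side r k) :
    lowPart n τ side (letter π) ∈
      ChainFree r k ((lowPart n τ side (letter π)).map Prod.fst) := by
  refine ⟨rfl, fun q hq => ?_, fun hc => h.2.2 (hasChain_lowPart.1 hc)⟩
  obtain ⟨hq1, hq2⟩ := List.mem_filter.1 hq
  obtain ⟨j, hj, rfl⟩ := List.mem_map.1 hq1
  exact ⟨((canonical_letter h.1).1 h.2.1 j (List.mem_range.1 hj)).1, by simpa using hq2⟩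

theorem ncard_canonicalChainFree {n k : ℕ} (hk : 1 ≤ k) (τ : List ℕ) {side : ℕ → List ℕ}
    (hs : IsSide n side) :
    (canonicalChainFree n τ side (· < ·) k).ncard =
      (canonicalChainFree n τ side (· > ·) k).ncard := by
  let e : ∀ H : List ℕ, Unimodal H → (ChainFree (· < ·) k H ≃ ChainFree (· > ·) k H) :=
    fun H hH => (hH.nonempty_equiv hk).some
  have he : ∀ {H H' : List ℕ} (hH : Unimodal H) (hH' : Unimodal H') {u v : List (ℕ × ℕ)}
      (hu : u ∈ ChainFree (· < ·) k H) (hv : v ∈ ChainFree (· < ·) k H'), H = H' →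
      (e H hH ⟨u, hu⟩).1 = (e H' hH' ⟨v, hv⟩).1 → u = v := by
    rintro H H' hH hH' u v hu hv rfl h
    have := (e H hH).injective (Subtype.ext h)
    exact congrArg Subtype.val this
  have hex : ∀ π (hπ : π ∈ canonicalChainFree n τ side (· < ·) k),
      ∃ π' : List ℕ, π'.length = n ∧ Related n τ side (letter π) (letter π') ∧
        lowPart n τ side (letter π') =
          (e _ (unimodal_lowPart τ hs (letter π)) ⟨_, lowPart_mem_chainFree hπ⟩).1 := by
    intro π hπ
    have hu := (e _ (unimodal_lowPart τ hs (letter π)) ⟨_, lowPart_mem_chainFree hπ⟩).2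
    exact exists_related hs hu.1 hu.2.1
  choose f hlen hrel hlow using hex
  refine Set.ncard_congr f ?_ ?_ ?_
  · intro π hπ
    refine ⟨hlen π hπ, (canonical_letter (hlen π hπ)).2 ((hrel π hπ).canonical
      ((canonical_letter hπ.1).1 hπ.2.1)), fun hc => ?_⟩
    rw [← hasChain_lowPart, hlow] at hc
    exact (e _ (unimodal_lowPart τ hs (letter π)) ⟨_, lowPart_mem_chainFree hπ⟩).2.2.2 hc
  · intro π₁ π₂ h₁ h₂ heq
    have r₁ := (hrel π₁ h₁).symm hs ((canonical_letter h₁.1).1 h₁.2.1)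
    have r₂ := (hrel π₂ h₂).symm hs ((canonical_letter h₂.1).1 h₂.2.1)
    rw [← heq] at r₂
    refine r₁.eq_of_lowPart_eq hs h₁.1 h₂.1 r₂ ?_
    refine he (unimodal_lowPart τ hs (letter π₁)) (unimodal_lowPart τ hs (letter π₂))
      (lowPart_mem_chainFree h₁) (lowPart_mem_chainFree h₂)
      ((r₁.map_fst_lowPart hs).trans (r₂.map_fst_lowPart hs).symm) ?_
    rw [← hlow π₁ h₁, ← hlow π₂ h₂, heq]
  · intro π' h'
    have hc' := (canonical_letter h'.1).1 h'.2.1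
    have hU := unimodal_lowPart τ hs (letter π')
    obtain ⟨⟨u, hu⟩, hudef⟩ : ∃ u, u = (e _ hU).symm ⟨_, lowPart_mem_chainFree h'⟩ := ⟨_, rfl⟩
    obtain ⟨π, hl, hr, hlw⟩ := exists_related hs hu.1 hu.2.1
    have hπ : π ∈ canonicalChainFree n τ side (· < ·) k := by
      refine ⟨hl, (canonical_letter hl).2 (hr.canonical hc'), fun hc => hu.2.2 ?_⟩
      rwa [← hasChain_lowPart, hlw] at hc
    refine ⟨π, hπ, ?_⟩
    refine (hrel π hπ).eq_of_lowPart_eq hs (hlen π hπ) h'.1 (hr.symm hs hc') ?_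
    rw [hlow π hπ]
    have key : ∀ {H H' : List ℕ} (hH : Unimodal H) (hH' : Unimodal H') {u v : List (ℕ × ℕ)}
        (hu : u ∈ ChainFree (· < ·) k H) (hv : v ∈ ChainFree (· < ·) k H'), H = H' → u = v →
        (e H hH ⟨u, hu⟩).1 = (e H' hH' ⟨v, hv⟩).1 := by
      rintro H H' hH hH' u v hu hv rfl rfl; rfl
    rw [key (unimodal_lowPart τ hs (letter π)) hU (lowPart_mem_chainFree hπ) hu
      (hr.map_fst_lowPart hs) hlw, hudef, Equiv.apply_symm_apply]

lemma containsPat_iff {π σ : List ℕ} :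
    ContainsPat π σ ↔ ∃ g : ℕ → ℕ, StrictMonoOn g {x | x ∈ σ} ∧ (σ.map g).Sublist π := by
  constructor
  · rintro ⟨f, hf, h⟩
    have hfac : Function.FactorsThrough (π.get ∘ f) σ.get := by
      intro i j hij
      have h1 := h i j
      have h2 := h j i
      simp only [Function.comp_apply]
      omega
    have hg : ∀ i, Function.extend σ.get (π.get ∘ f) 0 (σ.get i) = π.get (f i) :=
      fun i => hfac.extend_apply 0 i
    refine ⟨Function.extend σ.get (π.get ∘ f) 0, ?_, ?_⟩
    · intro x hx y hy hxy
      obtain ⟨i, rfl⟩ := List.get_of_mem hx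
      obtain ⟨j, rfl⟩ := List.get_of_mem hy
      rw [hg, hg]
      exact (h i j).1 hxy
    · rw [List.sublist_iff_exists_fin_orderEmbedding_get_eq]
      refine ⟨(Fin.castOrderIso (List.length_map _)).toOrderEmbedding.trans
        (OrderEmbedding.ofStrictMono f hf), fun i => ?_⟩
      have := hg (i.cast (List.length_map _))
      simpa using this
  · rintro ⟨g, hg, h⟩
    rw [List.sublist_iff_exists_fin_orderEmbedding_get_eq] at h
    obtain ⟨f, hf⟩ := h
    refine ⟨fun i => f (i.cast (List.length_map _).symm),
      fun i j hij => f.strictMono (by simpa using hij), fun i j => ?_⟩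
    rw [← hf, ← hf]
    have := hg.lt_iff_lt (List.get_mem σ i) (List.get_mem σ j)
    simpa using this.symm

/-- The list `l`, reversed if `s` holds. -/
def orient (s : Bool) (l : List ℕ) : List ℕ := bif s then l.reverse else l

/-- The order `<`, reversed if `s` holds. -/
def ordering (s : Bool) : ℕ → ℕ → Prop := bif s then (· > ·) else (· < ·)

lemma pairwise_orient {s : Bool} {l : List ℕ} :
    (orient s l).Pairwise (· < ·) ↔ l.Pairwise (ordering s) := by
  cases s <;> simp [orient, ordering, List.pairwise_reverse]

@[simp] lemma mem_orient {s : Bool} {l : List ℕ} {x : ℕ} : x ∈ orient s l ↔ x ∈ l := by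
  cases s <;> simp [orient]

@[simp] lemma length_orient {s : Bool} {l : List ℕ} : (orient s l).length = l.length := by
  cases s <;> simp [orient]

@[simp] lemma orient_orient {s : Bool} {l : List ℕ} : orient s (orient s l) = l := by
  cases s <;> simp [orient]

lemma map_orient {s : Bool} {l : List ℕ} (g : ℕ → ℕ) :
    (orient s l).map g = orient s (l.map g) := by
  cases s <;> simp [orient]

/-- The list `a`, followed by an oriented copy of `a` and by `t`, where `t` comes first if
`inner` holds. -/
def frame (inner s : Bool) (a t : List ℕ) : List ℕ :=
  a ++ bif inner then t ++ orient s a else orient s a ++ t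

lemma map_frame {inner s : Bool} {a t : List ℕ} (g : ℕ → ℕ) :
    (frame inner s a t).map g = frame inner s (a.map g) (t.map g) := by
  cases inner <;> simp [frame, map_orient]

lemma mem_frame {inner s : Bool} {a t : List ℕ} {x : ℕ} :
    x ∈ frame inner s a t ↔ x ∈ a ∨ x ∈ t := by
  cases inner <;> simp only [frame, cond_true, cond_false, List.mem_append, mem_orient] <;> tauto

lemma mem_iota {k x : ℕ} : x ∈ iota k ↔ 1 ≤ x ∧ x ≤ k := by
  simp only [iota, List.mem_map, List.mem_range]
  exact ⟨by rintro ⟨y, h, rfl⟩; omega, fun h => ⟨x - 1, by omega, by omega⟩⟩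

lemma pairwise_iota (k : ℕ) : (iota k).Pairwise (· < ·) :=
  List.pairwise_map.2 (List.pairwise_lt_range.imp (by intro a b h; omega))

lemma containsPat_frame {inner s : Bool} {π τ : List ℕ} {k : ℕ} (hτ : ∀ x ∈ τ, 1 ≤ x) :
    ContainsPat π (frame inner s (iota k) (τ.map (· + k))) ↔
      ∃ (a : List ℕ) (g : ℕ → ℕ), a.length = k ∧ a.Pairwise (· < ·) ∧
        StrictMonoOn g {x | x ∈ τ} ∧ (∀ x ∈ a, ∀ y ∈ τ, x < g y) ∧
        (frame inner s a (τ.map g)).Sublist π := by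
  rw [containsPat_iff]
  simp only [mem_frame, mem_iota, List.mem_map, map_frame]
  constructor
  · rintro ⟨g, hg, h⟩
    refine ⟨(iota k).map g, fun x => g (x + k), by simp [iota], ?_, ?_, ?_, ?_⟩
    · rw [List.pairwise_map]
      exact (pairwise_iota k).imp_of_mem fun hx hy hxy =>
        hg (Or.inl (mem_iota.1 hx)) (Or.inl (mem_iota.1 hy)) hxy
    · intro x hx y hy hxy
      exact hg (Or.inr ⟨x, hx, rfl⟩) (Or.inr ⟨y, hy, rfl⟩) (by omega)
    · intro x hx y hy
      obtain ⟨z, hz, rfl⟩ := List.mem_map.1 hx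
      have hz := mem_iota.1 hz
      have := hτ y hy
      exact hg (Or.inl hz) (Or.inr ⟨y, hy, rfl⟩) (by omega)
    · simpa [Function.comp_def] using h
  · rintro ⟨a, g, rfl, hp, hg, hag, h⟩
    have ha : (iota a.length).map
        (fun x => if x ≤ a.length then a.getD (x - 1) 0 else g (x - a.length)) = a := by
      apply List.ext_getElem
      · simp [iota]
      · intro i h1 h2
        simp [iota, Nat.succ_le_of_lt h2, h2]
    have ht : (τ.map (· + a.length)).map
        (fun x => if x ≤ a.length then a.getD (x - 1) 0 else g (x - a.length)) = τ.map g := by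
      rw [List.map_map]
      refine List.map_congr_left fun x hx => ?_
      have := hτ x hx
      simp [show x ≠ 0 by omega]
    refine ⟨_, ?_, by rwa [ha, ht]⟩
    rw [List.pairwise_iff_getElem] at hp
    rintro x hx y hy hxy
    dsimp only
    rcases hx with hx | ⟨x, hx, rfl⟩ <;> rcases hy with hy | ⟨y, hy, rfl⟩
    · rw [if_pos hx.2, if_pos hy.2, List.getD_eq_getElem _ _ (by omega),
        List.getD_eq_getElem _ _ (by omega)]
      exact hp _ _ _ _ (by omega)
    · have := hτ y hy
      rw [if_pos hx.2, if_neg (by omega), List.getD_eq_getElem _ _ (by omega),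
        Nat.add_sub_cancel]
      exact hag _ (List.getElem_mem _) y hy
    · have := hτ x hx
      omega
    · have := hτ x hx
      have := hτ y hy
      rw [if_neg (by omega), if_neg (by omega), Nat.add_sub_cancel, Nat.add_sub_cancel]
      exact hg hx hy (by omega)

lemma sublist_of_subset {l m : List ℕ} (hl : l.Pairwise (· < ·)) (hm : m.Pairwise (· < ·))
    (h : l ⊆ m) : l.Sublist m :=
  List.sublist_of_subperm_of_pairwise (List.subperm_of_subset hl.nodup h) hl hm

lemma pairwise_after (n j : ℕ) : (after n j).Pairwise (· < ·) :=
  List.pairwise_lt_range.sublist (List.drop_sublist _ _)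

lemma Canonical.sublist_map_range {n : ℕ} {p : ℕ → ℕ} (hp : Canonical n p) {j : ℕ} (hj : j ≤ n)
    {a : List ℕ} (ha : a.Pairwise (· < ·)) (h : ∀ x ∈ a, 1 ≤ x ∧ x ≤ prefixMax p j) :
    a.Sublist ((List.range j).map p) := by
  induction j generalizing a with
  | zero =>
    rcases a with _ | ⟨x, a⟩
    · exact List.nil_sublist _
    · have := h x (by simp)
      simp [prefixMax] at this
      omega
  | succ j ih =>
    rw [List.range_succ, List.map_append]
    by_cases hall : ∀ x ∈ a, x ≤ prefixMax p j
    · exact (ih (by omega) ha fun x hx => ⟨(h x hx).1, hall x hx⟩).trans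
        (List.sublist_append_left _ _)
    · push Not at hall
      obtain ⟨x, hx, hlt⟩ := hall
      obtain rfl | ⟨a, y, rfl⟩ := List.eq_nil_or_concat a
      · simp at hx
      rw [List.concat_eq_append] at *
      rw [List.pairwise_append] at ha
      have hpj := hp j hj
      have hle : ∀ z, z ∈ a ++ [y] → z ≤ prefixMax p j + 1 := fun z hz => by
        have := (h z hz).2
        rw [prefixMax_succ] at this
        omega
      have hxy : x ≤ y := by
        rcases List.mem_append.1 hx with hx | hx
        · exact (ha.2.2 x hx y (by simp)).le
        · rw [List.mem_singleton.1 hx]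
      have hy := hle y (by simp)
      have hy' := (h y (by simp)).2
      rw [prefixMax_succ] at hy'
      have hyp : y = p j := by omega
      refine (ih (by omega) ha.1 fun z hz => ⟨(h z (by simp [hz])).1, ?_⟩).append
        (by simp [hyp])
      have := ha.2.2 z hz y (by simp)
      omega

/-- The positions at which the inner part of a frame is sought. -/
def framedSide (inner : Bool) (n : ℕ) : ℕ → List ℕ := bif inner then List.range else after n

lemma isSide_framedSide (inner : Bool) (n : ℕ) : IsSide n (framedSide inner n) := by
  cases inner
  · exact isSide_after n
  · exact isSide_range n

section
variable {inner s : Bool} {n k : ℕ} {p : ℕ → ℕ} {τ : List ℕ}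

lemma hasChain_of_frame_sublist (hp : Canonical n p) {a : List ℕ} {g : ℕ → ℕ}
    (ha : a.Pairwise (· < ·)) (hg : StrictMonoOn g {x | x ∈ τ})
    (hag : ∀ x ∈ a, ∀ y ∈ τ, x < g y)
    (h : (frame inner s a (τ.map g)).Sublist ((List.range n).map p)) :
    HasChain (ordering s) a.length (annotate n τ (framedSide inner n) p) := by
  obtain ⟨L, hL, he⟩ := List.sublist_map_iff.1 h
  obtain ⟨ja, jr, rfl, hja, hjr⟩ := List.map_eq_append_iff.1 he.symm
  obtain ⟨jt, jb, hjt, hjb, hbr, hbef, hside⟩ : ∃ jt jb : List ℕ, jt.map p = τ.map g ∧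
      jb.map p = orient s a ∧ jb.Sublist jr ∧ (∀ i ∈ ja, ∀ j ∈ jb, i < j) ∧
      ∀ j ∈ jb, jt.Sublist (framedSide inner n j) := by
    have hpw := List.pairwise_lt_range.sublist hL
    rw [List.pairwise_append] at hpw
    have hlt : ∀ j ∈ jr, j < n := fun j hj =>
      List.mem_range.1 (hL.subset (List.mem_append_right _ hj))
    cases inner
    · obtain ⟨jb, jt, rfl, hjb, hjt⟩ := List.map_eq_append_iff.1 hjr
      have hpr := List.pairwise_append.1 hpw.2.1
      exact ⟨jt, jb, hjt, hjb, List.sublist_append_left _ _,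
        fun i hi j hj => hpw.2.2 i hi j (by simp [hj]),
        fun j hj => sublist_of_subset hpr.2.1 (pairwise_after n j) fun l hl =>
          mem_after.2 ⟨hpr.2.2 j hj l hl, hlt l (by simp [hl])⟩⟩
    · obtain ⟨jt, jb, rfl, hjt, hjb⟩ := List.map_eq_append_iff.1 hjr
      have hpr := List.pairwise_append.1 hpw.2.1
      exact ⟨jt, jb, hjt, hjb, List.sublist_append_right _ _,
        fun i hi j hj => hpw.2.2 i hi j (by simp [hj]),
        fun j hj => sublist_of_subset hpr.1 List.pairwise_lt_range fun l hl =>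
          List.mem_range.2 (hpr.2.2 l hl j hj)⟩
  have hbn : jb.Sublist (List.range n) :=
    (hbr.trans (List.sublist_append_right _ _)).trans hL
  refine ⟨jb.map fun j => (height τ (framedSide inner n) p j, p j), hbn.map _, ?_, ?_, ?_⟩
  · simpa using congrArg List.length hjb
  · have : (jb.map p).Pairwise (ordering s) := by
      rw [hjb, ← pairwise_orient, orient_orient]
      exact ha
    exact List.pairwise_map.2 (List.pairwise_map.1 this)
  · simp only [List.forall_mem_map]
    intro i hi j hj
    have hia : p i ∈ a := by
      rw [← mem_orient (s := s), ← hjb]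
      exact List.mem_map_of_mem hi
    obtain ⟨l, hl, hli⟩ := List.mem_map.1 (hja ▸ hia)
    refine (le_height (hp i (List.mem_range.1 (hbn.subset hi))).1).2
      ⟨hli ▸ le_prefixMax (hbef l hl j hj), g, hg, hag _ hia, ?_⟩
    rw [← hjt]
    exact (hside j hj).map p

lemma exists_frame_sublist (hk : 1 ≤ k) (hp : Canonical n p)
    (h : HasChain (ordering s) k (annotate n τ (framedSide inner n) p)) :
    ∃ (a : List ℕ) (g : ℕ → ℕ), a.length = k ∧ a.Pairwise (· < ·) ∧
      StrictMonoOn g {x | x ∈ τ} ∧ (∀ x ∈ a, ∀ y ∈ τ, x < g y) ∧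
      (frame inner s a (τ.map g)).Sublist ((List.range n).map p) := by
  obtain ⟨c, hc, rfl, hr, hle⟩ := h
  obtain ⟨js, hjs, rfl⟩ := List.sublist_map_iff.1 hc
  simp only [List.forall_mem_map, List.length_map, List.pairwise_map] at hk hr hle ⊢
  have hne : js.toFinset.Nonempty := by
    rw [List.toFinset_nonempty_iff]
    rintro rfl
    simp at hk
  obtain ⟨i₀, hi₀, hmax⟩ := Finset.exists_max_image js.toFinset p hne
  obtain ⟨f, hf, hfirst⟩ := Finset.exists_min_image js.toFinset id hne
  obtain ⟨l, hl, hlast⟩ := Finset.exists_max_image js.toFinset id hne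
  simp only [List.mem_toFinset, id] at hi₀ hmax hf hfirst hl hlast
  have hn : ∀ j ∈ js, j < n := fun j hj => List.mem_range.1 (hjs.subset hj)
  have hpos : ∀ j ∈ js, 1 ≤ p j := fun j hj => (hp j (hn j hj)).1
  have hheight := fun j hj => (le_height (hpos i₀ hi₀)).1 (hle i₀ hi₀ j hj)
  have ha : (orient s (js.map p)).Pairwise (· < ·) :=
    pairwise_orient.2 (List.pairwise_map.2 hr)
  have hjp := List.pairwise_lt_range.sublist hjs
  suffices ∃ (g : ℕ → ℕ) (j₁ : ℕ) (jt : List ℕ), StrictMonoOn g {x | x ∈ τ} ∧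
      (∀ y ∈ τ, p i₀ < g y) ∧ jt.map p = τ.map g ∧ j₁ ≤ n ∧ p i₀ ≤ prefixMax p j₁ ∧
      (bif inner then jt ++ js else js ++ jt).Pairwise (· < ·) ∧
      ∀ x ∈ (bif inner then jt ++ js else js ++ jt), j₁ ≤ x ∧ x < n by
    obtain ⟨g, j₁, jt, hg, hig, hjt, hj₁, hpm, hpw, hbd⟩ := this
    obtain ⟨ja, hja, hae⟩ := List.sublist_map_iff.1 (hp.sublist_map_range hj₁ ha fun x hx => by
      obtain ⟨j, hj, rfl⟩ := List.mem_map.1 (mem_orient.1 hx)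
      exact ⟨hpos j hj, (hmax j hj).trans hpm⟩)
    refine ⟨orient s (js.map p), g, by simp, ha, hg, fun x hx y hy => ?_, ?_⟩
    · obtain ⟨j, hj, rfl⟩ := List.mem_map.1 (mem_orient.1 hx)
      exact (hmax j hj).trans_lt (hig y hy)
    · have hfr : frame inner s (orient s (js.map p)) (τ.map g) =
          (ja ++ bif inner then jt ++ js else js ++ jt).map p := by
        cases inner <;> simp [frame, hae.symm, hjt]
      rw [hfr]
      refine List.Sublist.map p (sublist_of_subset ?_ List.pairwise_lt_range fun x hx => ?_)
      · exact List.pairwise_append.2 ⟨List.pairwise_lt_range.sublist hja, hpw, fun x hx y hy =>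
          (List.mem_range.1 (hja.subset hx)).trans_le (hbd y hy).1⟩
      · rw [List.mem_range]
        rcases List.mem_append.1 hx with hx | hx
        · exact (List.mem_range.1 (hja.subset hx)).trans_le hj₁
        · exact (hbd x hx).2
  cases inner
  · obtain ⟨-, g, hg, hig, hsub⟩ := hheight l hl
    obtain ⟨jt, hjt, he⟩ := List.sublist_map_iff.1 hsub
    have hmem : ∀ x ∈ jt, l < x ∧ x < n := fun x hx => mem_after.1 (hjt.subset hx)
    refine ⟨g, f, jt, hg, hig, he.symm, (hn f hf).le, (hheight f hf).1, ?_, fun x hx => ?_⟩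
    · exact List.pairwise_append.2 ⟨hjp, (pairwise_after n l).sublist hjt, fun x hx y hy =>
        (hlast x hx).trans_lt (hmem y hy).1⟩
    · rcases List.mem_append.1 hx with hx | hx
      · exact ⟨hfirst x hx, hn x hx⟩
      · exact ⟨((hfirst l hl).trans_lt (hmem x hx).1).le, (hmem x hx).2⟩
  · obtain ⟨hpm, g, hg, hig, hsub⟩ := hheight f hf
    obtain ⟨jt, hjt, he⟩ := List.sublist_map_iff.1 hsub
    have hmem : ∀ x ∈ jt, x < f := fun x hx => List.mem_range.1 (hjt.subset hx)
    have hpt := List.pairwise_lt_range.sublist hjt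
    obtain ⟨j₁, hj₁f, hj₁, hpm₁⟩ : ∃ j₁ ≤ f, (∀ x ∈ jt, j₁ ≤ x) ∧ p i₀ ≤ prefixMax p j₁ := by
      rcases jt with _ | ⟨j₁, jt⟩
      · exact ⟨f, le_rfl, by simp, hpm⟩
      · have hlt := hmem j₁ (by simp)
        refine ⟨j₁, hlt.le, ?_, ?_⟩
        · rw [List.forall_mem_cons]
          exact ⟨le_rfl, fun x hx => (List.rel_of_pairwise_cons hpt hx).le⟩
        · have hm : p j₁ ∈ τ.map g := he ▸ List.mem_map_of_mem (by simp)
          obtain ⟨y, hy, hyp⟩ := List.mem_map.1 hm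
          have h1 := hig y hy
          have h2 := (hp j₁ (hlt.trans (hn f hf))).2
          omega
    refine ⟨g, j₁, jt, hg, hig, he.symm, hj₁f.trans (hn f hf).le, hpm₁, ?_, fun x hx => ?_⟩
    · exact List.pairwise_append.2 ⟨hpt, hjp, fun x hx y hy =>
        (hmem x hx).trans_le (hfirst y hy)⟩
    · rcases List.mem_append.1 hx with hx | hx
      · exact ⟨hj₁ x hx, (hmem x hx).trans (hn f hf)⟩
      · exact ⟨hj₁f.trans (hfirst x hx), hn x hx⟩

end

lemma pAvoid_frame {τ : List ℕ} (hτ : IsCanonicalSeq τ) {k : ℕ} (hk : 1 ≤ k)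
    (inner s : Bool) (n : ℕ) :
    pAvoid n (frame inner s (iota k) (τ.map (· + k))) =
      (canonicalChainFree n τ (framedSide inner n) (ordering s) k).ncard := by
  have hτ' : ∀ x ∈ τ, 1 ≤ x := by
    intro x hx
    obtain ⟨i, rfl⟩ := List.get_of_mem hx
    exact (hτ i i.2).1
  unfold pAvoid canonicalChainFree AvoidsPat
  congr 1
  ext π
  refine and_congr_right fun hn => and_congr_right fun hπ => not_congr ?_
  have hp := (canonical_letter hn).1 hπ
  have hmap : (List.range n).map (letter π) = π := hn ▸ map_letter_range π
  rw [containsPat_frame hτ']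
  constructor
  · rintro ⟨a, g, rfl, ha, hg, hag, h⟩
    exact hasChain_of_frame_sublist hp ha hg hag (hmap.symm ▸ h)
  · intro h
    exact hmap ▸ exists_frame_sublist hk hp h

lemma patEquiv_frame {τ : List ℕ} (hτ : IsCanonicalSeq τ) {k : ℕ} (hk : 1 ≤ k) (inner : Bool) :
    PatEquiv (frame inner false (iota k) (τ.map (· + k)))
      (frame inner true (iota k) (τ.map (· + k))) := by
  intro n
  rw [pAvoid_frame hτ hk, pAvoid_frame hτ hk]
  exact ncard_canonicalChainFree hk τ (isSide_framedSide inner n)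

end PartitionPattern

/-- For a canonical sequence τ and k ≥ 1, the pattern
1…k(τ+k)1…k is equivalent to 1…k(τ+k)k…1, and 1…k1…k(τ+k) is
equivalent to 1…k k…1(τ+k). -/
theorem statement1 (τ : List ℕ) (hτ : IsCanonicalSeq τ) (k : ℕ) (hk : 1 ≤ k) :
    PatEquiv (iota k ++ τ.map (· + k) ++ iota k)
             (iota k ++ τ.map (· + k) ++ (iota k).reverse) ∧
    PatEquiv (iota k ++ iota k ++ τ.map (· + k))
             (iota k ++ (iota k).reverse ++ τ.map (· + k)) := by
  simp only [List.append_assoc]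
  exact ⟨PartitionPattern.patEquiv_frame hτ hk true, PartitionPattern.patEquiv_frame hτ hk false⟩
end

section
/- Let k ≥ 1, let s₁ > s₂ > ⋯ > s_m and t₁ > t₂ > ⋯ > t_m be two strictly decreasing sequences of elements of {1,…,k}, and let r₁,…,r_m be positive integers. Define the weakly decreasing sequences S = s₁^{r₁} s₂^{r₂} ⋯ s_m^{r_m} and T = t₁^{r₁} t₂^{r₂} ⋯ t_m^{r_m}. Then for every canonical sequence τ of a partition, the pattern 12⋯k(τ+k)S is equivalent to the pattern 12⋯k(τ+k)T. -/
theorem containsPat_iff {π σ : List ℕ} :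
    ContainsPat π σ ↔ ∃ φ : ℕ → ℕ, StrictMonoOn φ {a | a ∈ σ} ∧ (σ.map φ).Sublist π := by
  constructor
  · rintro ⟨f, hf, h⟩
    have heq : ∀ i j, σ.get i = σ.get j → π.get (f i) = π.get (f j) := by
      intro i j hij
      have h₁ := h i j
      have h₂ := h j i
      omega
    classical
    let φ : ℕ → ℕ := fun a => if ha : ∃ i, σ.get i = a then π.get (f ha.choose) else 0
    have hφ : ∀ i, φ (σ.get i) = π.get (f i) := by
      intro i
      have ha : ∃ j, σ.get j = σ.get i := ⟨i, rfl⟩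
      simp only [φ, dif_pos ha]
      exact heq _ _ ha.choose_spec
    refine ⟨φ, ?_, ?_⟩
    · intro a ha b hb hab
      obtain ⟨i, rfl⟩ := List.mem_iff_get.1 ha
      obtain ⟨j, rfl⟩ := List.mem_iff_get.1 hb
      rw [hφ, hφ]
      exact (h i j).1 hab
    · have hl : (σ.map φ).length = σ.length := List.length_map _
      rw [List.sublist_iff_exists_fin_orderEmbedding_get_eq]
      refine ⟨OrderEmbedding.ofStrictMono (fun i => f (Fin.cast hl i))
        (fun i j hij => hf (by simpa using hij)), fun i => ?_⟩
      rw [List.get_eq_getElem, List.getElem_map]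
      exact hφ (Fin.cast hl i)
  · rintro ⟨φ, hφ, h⟩
    rw [List.sublist_iff_exists_fin_orderEmbedding_get_eq] at h
    obtain ⟨f, hf⟩ := h
    have hl : σ.length = (σ.map φ).length := (List.length_map _).symm
    refine ⟨fun i => f (Fin.cast hl i), fun i j hij => f.strictMono (by simpa using hij),
      fun i j => ?_⟩
    have h₁ := hf (Fin.cast hl i)
    have h₂ := hf (Fin.cast hl j)
    simp only [List.get_eq_getElem, List.getElem_map, Fin.val_cast] at h₁ h₂
    simp only [List.get_eq_getElem] at h₁ h₂ ⊢
    rw [← h₁, ← h₂]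
    exact (hφ.lt_iff_lt (List.getElem_mem _) (List.getElem_mem _)).symm

theorem isCanonicalSeq_concat {w : List ℕ} {a : ℕ} :
    IsCanonicalSeq (w ++ [a]) ↔ IsCanonicalSeq w ∧ 1 ≤ a ∧ a ≤ w.foldr max 0 + 1 := by
  constructor
  · intro h
    refine ⟨fun i hi => ?_, ?_⟩
    · have := h i (by simp; omega)
      simpa [List.getElem_append_left hi, List.take_append_of_le_length hi.le] using this
    · simpa using h w.length (by simp)
  · rintro ⟨h, ha⟩ i hi
    rcases Nat.lt_or_ge i w.length with hi' | hi'
    · simpa [List.getElem_append_left hi', List.take_append_of_le_length hi'.le] using h i hi'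
    · obtain rfl : i = w.length := by simp at hi; omega
      simpa using ha

theorem IsCanonicalSeq.of_append {w v : List ℕ} (h : IsCanonicalSeq (w ++ v)) :
    IsCanonicalSeq w := by
  induction v using List.reverseRecOn with
  | nil => simpa using h
  | append_singleton v a ih =>
    rw [← List.append_assoc] at h
    exact ih (isCanonicalSeq_concat.1 h).1

theorem IsCanonicalSeq.one_le {w : List ℕ} (h : IsCanonicalSeq w) {a : ℕ} (ha : a ∈ w) :
    1 ≤ a := by
  obtain ⟨⟨i, hi⟩, rfl⟩ := List.mem_iff_get.1 ha
  exact (h i hi).1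

theorem iota_succ (k : ℕ) : iota (k + 1) = iota k ++ [k + 1] := by
  simp [iota, List.range_succ]

theorem mem_iota {k a : ℕ} : a ∈ iota k ↔ 1 ≤ a ∧ a ≤ k := by
  simp only [iota, List.mem_map, List.mem_range]
  constructor
  · rintro ⟨b, hb, rfl⟩
    omega
  · intro h
    exact ⟨a - 1, by omega, by omega⟩

theorem pairwise_iota (k : ℕ) : (iota k).Pairwise (· < ·) := by
  rw [iota, List.pairwise_map]
  exact List.pairwise_lt_range.imp (by intro a b h; omega)

theorem le_foldr_max {w : List ℕ} {a : ℕ} (h : a ∈ w) : a ≤ w.foldr max 0 := by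
  induction w with
  | nil => simp at h
  | cons b w ih =>
    rcases List.mem_cons.1 h with rfl | h
    · simp
    · exact (ih h).trans (by simp)

theorem foldr_max_concat (w : List ℕ) (a : ℕ) :
    (w ++ [a]).foldr max 0 = max (w.foldr max 0) a := by
  induction w with
  | nil => simp
  | cons b w ih =>
    rw [List.cons_append, List.foldr_cons, ih, List.foldr_cons, max_assoc]

theorem IsCanonicalSeq.iota_sublist {w : List ℕ} (h : IsCanonicalSeq w) :
    (iota (w.foldr max 0)).Sublist w := by
  induction w using List.reverseRecOn with
  | nil => simp [iota]
  | append_singleton w a ih =>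
    obtain ⟨hw, -, ha⟩ := isCanonicalSeq_concat.1 h
    rw [foldr_max_concat]
    rcases Nat.lt_or_ge (w.foldr max 0) a with h' | h'
    · obtain rfl : a = w.foldr max 0 + 1 := by omega
      rw [max_eq_right h'.le, iota_succ]
      exact (ih hw).append (List.Sublist.refl _)
    · rw [max_eq_left h']
      exact (ih hw).trans (List.sublist_append_left _ _)

theorem sublist_iota {l : List ℕ} {h : ℕ} (hl : l.Pairwise (· < ·))
    (hb : ∀ a ∈ l, 1 ≤ a ∧ a ≤ h) : l.Sublist (iota h) := by
  refine List.sublist_of_subperm_of_pairwise ?_ hl (pairwise_iota h)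
  exact List.subperm_of_subset (hl.imp fun h => h.ne) fun a ha => mem_iota.2 (hb a ha)

theorem map_iota_sublist {φ : ℕ → ℕ} {c h : ℕ} (hφ : StrictMonoOn φ (Set.Icc 1 c))
    (hb : Set.MapsTo φ (Set.Icc 1 c) (Set.Icc 1 h)) : ((iota c).map φ).Sublist (iota h) := by
  refine sublist_iota ?_ ?_
  · rw [List.pairwise_map]
    exact (pairwise_iota c).imp_of_mem fun ha hb' => hφ (mem_iota.1 ha) (mem_iota.1 hb')
  · intro a ha
    obtain ⟨b, hb', rfl⟩ := List.mem_map.1 ha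
    exact hb (mem_iota.1 hb')

/-- `w` contains the letter `y` followed by a copy of `Θ` whose letters all exceed `y`. -/
def OccursAbove (Θ w : List ℕ) (y : ℕ) : Prop :=
  ∃ ψ : ℕ → ℕ, StrictMonoOn ψ {a | a ∈ Θ} ∧ (∀ a ∈ Θ, y < ψ a) ∧ (y :: Θ.map ψ).Sublist w

/-- The largest letter above which a copy of `Θ` occurs in `w` (and `0` if there is none). -/
noncomputable def height (Θ w : List ℕ) : ℕ := sSup {y | OccursAbove Θ w y}

theorem OccursAbove.mem {Θ w : List ℕ} {y : ℕ} (h : OccursAbove Θ w y) : y ∈ w := by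
  obtain ⟨ψ, -, -, h⟩ := h
  exact h.subset (by simp)

theorem OccursAbove.mono {Θ w w' : List ℕ} {y : ℕ} (h : OccursAbove Θ w y)
    (hw : w.Sublist w') : OccursAbove Θ w' y := by
  obtain ⟨ψ, h₁, h₂, h₃⟩ := h
  exact ⟨ψ, h₁, h₂, h₃.trans hw⟩

theorem OccursAbove.of_filter {Θ w w' : List ℕ} {y h : ℕ} (hy : h < y)
    (hw : w.filter (h < ·) = w'.filter (h < ·)) (ho : OccursAbove Θ w y) :
    OccursAbove Θ w' y := by
  obtain ⟨ψ, h₁, h₂, h₃⟩ := ho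
  refine ⟨ψ, h₁, h₂, ?_⟩
  have h₄ := h₃.filter (h < ·)
  rw [hw, List.filter_eq_self.2] at h₄
  · exact h₄.trans List.filter_sublist
  · intro a ha
    rcases List.mem_cons.1 ha with rfl | ha
    · simpa using hy
    · obtain ⟨b, hb, rfl⟩ := List.mem_map.1 ha
      simpa using hy.trans (h₂ b hb)

theorem bddAbove_occursAbove (Θ w : List ℕ) : BddAbove {y | OccursAbove Θ w y} :=
  ⟨w.foldr max 0, fun _ hy => le_foldr_max (OccursAbove.mem hy)⟩

theorem OccursAbove.le_height {Θ w : List ℕ} {y : ℕ} (h : OccursAbove Θ w y) :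
    y ≤ height Θ w :=
  le_csSup (bddAbove_occursAbove Θ w) h

theorem occursAbove_height {Θ w : List ℕ} (h : 1 ≤ height Θ w) :
    OccursAbove Θ w (height Θ w) := by
  refine Nat.sSup_mem (s := {y | OccursAbove Θ w y}) ?_ (bddAbove_occursAbove Θ w)
  by_contra hne
  rw [Set.not_nonempty_iff_eq_empty] at hne
  simp [height, hne] at h

theorem height_mono {Θ w w' : List ℕ} (hw : w.Sublist w') : height Θ w ≤ height Θ w' := by
  rcases Nat.eq_zero_or_pos (height Θ w) with h | h
  · omega
  · exact ((occursAbove_height h).mono hw).le_height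

theorem height_le_foldr_max (Θ w : List ℕ) : height Θ w ≤ w.foldr max 0 := by
  rcases Nat.eq_zero_or_pos (height Θ w) with h | h
  · omega
  · exact le_foldr_max (occursAbove_height h).mem

theorem height_le_of_filter {Θ w' u u' : List ℕ} (hw' : w'.Sublist u')
    (hu : u.filter (height Θ w' < ·) = u'.filter (height Θ w' < ·)) :
    height Θ u ≤ height Θ u' := by
  rcases Nat.lt_or_ge (height Θ w') (height Θ u) with h | h
  · exact ((occursAbove_height (by omega)).of_filter h hu).le_height
  · exact h.trans (height_mono hw')

/-- The permutation of the letters that rotates `1, …, h` one step upwards. -/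
def cyc (h a : ℕ) : ℕ :=
  if a = 0 ∨ h < a then a else if a = h then 1 else a + 1

theorem cyc_injective (h : ℕ) : Function.Injective (cyc h) := by
  intro a b hab
  unfold cyc at hab
  split_ifs at hab <;> omega

theorem cyc_surjective (h : ℕ) : Function.Surjective (cyc h) := by
  intro b
  refine ⟨if b = 0 ∨ h < b then b else if b = 1 then h else b - 1, ?_⟩
  unfold cyc
  split_ifs <;> omega

theorem lt_cyc_iff {h a : ℕ} : h < cyc h a ↔ h < a := by
  unfold cyc
  split_ifs <;> omega

theorem cyc_of_lt {h a : ℕ} (h₁ : h < a) : cyc h a = a := by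
  simp [cyc, h₁]

theorem one_le_cyc_iff {h a : ℕ} : 1 ≤ cyc h a ↔ 1 ≤ a := by
  unfold cyc
  split_ifs <;> omega

/-- Rotate the low letters of `v`, where `w` is the part of the sequence preceding `v`. -/
noncomputable def rotateFrom (Θ : List ℕ) : List ℕ → List ℕ → List ℕ
  | _, [] => []
  | w, a :: v => cyc (height Θ w) a :: rotateFrom Θ (w ++ [a]) v

theorem rotateFrom_append (Θ w v₁ v₂ : List ℕ) :
    rotateFrom Θ w (v₁ ++ v₂) = rotateFrom Θ w v₁ ++ rotateFrom Θ (w ++ v₁) v₂ := by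
  induction v₁ generalizing w with
  | nil => simp [rotateFrom]
  | cons a v₁ ih => simp [rotateFrom, ih]

theorem rotateFrom_concat (Θ w : List ℕ) (a : ℕ) :
    rotateFrom Θ [] (w ++ [a]) = rotateFrom Θ [] w ++ [cyc (height Θ w) a] := by
  simp [rotateFrom_append, rotateFrom]

theorem length_rotateFrom (Θ w v : List ℕ) : (rotateFrom Θ w v).length = v.length := by
  induction v generalizing w with
  | nil => rfl
  | cons a v ih => simp [rotateFrom, ih]

theorem rotateFrom_injective (Θ w : List ℕ) : Function.Injective (rotateFrom Θ w) := by
  intro v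
  induction v generalizing w with
  | nil =>
    intro v' h
    cases v' with
    | nil => rfl
    | cons b v' => simp [rotateFrom] at h
  | cons a v ih =>
    intro v' h
    cases v' with
    | nil => simp [rotateFrom] at h
    | cons b v' =>
      simp only [rotateFrom, List.cons.injEq] at h
      obtain rfl := cyc_injective _ h.1
      rw [ih _ h.2]

theorem rotateFrom_surjective (Θ w : List ℕ) : Function.Surjective (rotateFrom Θ w) := by
  intro v
  induction v generalizing w with
  | nil => exact ⟨[], rfl⟩
  | cons b v ih =>
    obtain ⟨a, ha⟩ := cyc_surjective (height Θ w) b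
    obtain ⟨v', hv'⟩ := ih (w ++ [a])
    exact ⟨a :: v', by rw [rotateFrom, ha, hv']⟩

theorem filter_filter_lt {h h' : ℕ} (hh : h ≤ h') (u : List ℕ) :
    (u.filter (h < ·)).filter (h' < ·) = u.filter (h' < ·) := by
  rw [List.filter_filter]
  refine List.filter_congr fun a _ => ?_
  simp only [← Bool.decide_and, decide_eq_decide]
  omega

theorem height_rotateFrom (Θ w : List ℕ) :
    height Θ (rotateFrom Θ [] w) = height Θ w ∧
      (rotateFrom Θ [] w).filter (height Θ w < ·) = w.filter (height Θ w < ·) := by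
  induction w using List.reverseRecOn with
  | nil => simp [rotateFrom]
  | append_singleton w a ih =>
    obtain ⟨hh, hf⟩ := ih
    have key : (rotateFrom Θ [] (w ++ [a])).filter (height Θ w < ·) =
        (w ++ [a]).filter (height Θ w < ·) := by
      rw [rotateFrom_concat, List.filter_append, List.filter_append, hf]
      congr 1
      by_cases h : height Θ w < a
      · rw [cyc_of_lt h]
      · simp [h, lt_cyc_iff]
    have hle : height Θ w ≤ height Θ (w ++ [a]) := height_mono (List.sublist_append_left _ _)
    refine ⟨le_antisymm ?_ ?_, ?_⟩
    · exact height_le_of_filter (List.sublist_append_left w [a]) key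
    · refine height_le_of_filter (w' := rotateFrom Θ [] w) ?_ ?_
      · rw [rotateFrom_concat]
        exact List.sublist_append_left _ _
      · rw [hh, key]
    · rw [← filter_filter_lt hle, key, filter_filter_lt hle]

theorem foldr_max_rotateFrom (Θ w : List ℕ) :
    (rotateFrom Θ [] w).foldr max 0 = w.foldr max 0 := by
  induction w using List.reverseRecOn with
  | nil => simp [rotateFrom]
  | append_singleton w a ih =>
    rw [rotateFrom_concat, foldr_max_concat, foldr_max_concat, ih]
    have h := height_le_foldr_max Θ w
    rcases Nat.lt_or_ge (height Θ w) a with h' | h'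
    · rw [cyc_of_lt h']
    · have := (lt_cyc_iff (h := height Θ w) (a := a)).not.2 (by omega)
      rw [max_eq_left (by omega), max_eq_left (by omega)]

theorem isCanonicalSeq_rotateFrom {Θ w : List ℕ} :
    IsCanonicalSeq (rotateFrom Θ [] w) ↔ IsCanonicalSeq w := by
  induction w using List.reverseRecOn with
  | nil => simp [rotateFrom]
  | append_singleton w a ih =>
    rw [rotateFrom_concat, isCanonicalSeq_concat, isCanonicalSeq_concat, ih,
      foldr_max_rotateFrom, one_le_cyc_iff]
    have h := height_le_foldr_max Θ w
    rcases Nat.lt_or_ge (height Θ w) a with h' | h'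
    · rw [cyc_of_lt h']
    · have := (lt_cyc_iff (h := height Θ w) (a := a)).not.2 (by omega)
      have h₁ : cyc (height Θ w) a ≤ w.foldr max 0 + 1 := by omega
      have h₂ : a ≤ w.foldr max 0 + 1 := by omega
      simp [h₁, h₂]

/-- `π` contains a copy of `U`, a word over `1, …, c`, to the right of a prefix `w`, in such a way
that the letters `1, …, c` are represented by letters not exceeding the height of `w`. -/
def ContainsBelow (Θ : List ℕ) (c : ℕ) (U π : List ℕ) : Prop :=
  ∃ w v φ, π = w ++ v ∧ StrictMonoOn φ (Set.Icc 1 c) ∧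
    Set.MapsTo φ (Set.Icc 1 c) (Set.Icc 1 (height Θ w)) ∧ (U.map φ).Sublist v

theorem containsPat_iff_containsBelow {Θ U π : List ℕ} {c : ℕ} (hc : 1 ≤ c)
    (hΘ : ∀ a ∈ Θ, c < a) (hU : ∀ a ∈ U, 1 ≤ a ∧ a ≤ c) (hπ : IsCanonicalSeq π) :
    ContainsPat π (iota c ++ Θ ++ U) ↔ ContainsBelow Θ c U π := by
  have hcm : c ∈ iota c := mem_iota.2 ⟨hc, le_rfl⟩
  rw [containsPat_iff]
  constructor
  · rintro ⟨φ, hφ, h⟩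
    rw [List.map_append] at h
    obtain ⟨w, v, rfl, hw, hv⟩ := List.append_sublist_iff.1 h
    have hφc : StrictMonoOn φ (Set.Icc 1 c) := hφ.mono fun a ha => by
      have : a ∈ iota c := mem_iota.2 ha
      simp [this]
    have hocc : OccursAbove Θ w (φ c) := by
      refine ⟨φ, hφ.mono fun a (ha : a ∈ Θ) => by simp [ha], fun a ha => ?_, ?_⟩
      · exact hφ (by simp [hcm]) (by simp [ha]) (hΘ a ha)
      · refine List.Sublist.trans ?_ hw
        obtain ⟨d, rfl⟩ : ∃ d, c = d + 1 := ⟨c - 1, by omega⟩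
        rw [iota_succ]
        simp
    refine ⟨w, v, φ, rfl, hφc, fun a ha => ⟨?_, ?_⟩, hv⟩
    · refine hπ.one_le (a := φ a) (List.mem_append_left _ (hw.subset ?_))
      exact List.mem_map_of_mem (List.mem_append_left _ (mem_iota.2 ha))
    · exact (hφc.monotoneOn ha ⟨hc, le_rfl⟩ ha.2).trans hocc.le_height
  · rintro ⟨w, v, φ, rfl, hφ, hm, hv⟩
    have h1 := hm ⟨hc, le_rfl⟩
    obtain ⟨ψ, hψ, hψh, hs⟩ := occursAbove_height (h1.1.trans h1.2)
    obtain ⟨w₀, w₁, rfl, hw₀, hw₁⟩ := List.cons_sublist_iff.1 hs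
    have hcan : IsCanonicalSeq w₀ := hπ.of_append.of_append
    have hi : ((iota c).map φ).Sublist w₀ := by
      refine List.Sublist.trans ?_ hcan.iota_sublist
      exact map_iota_sublist hφ fun a ha => ⟨(hm ha).1, (hm ha).2.trans (le_foldr_max hw₀)⟩
    have hmem : ∀ a, a ∈ iota c ++ Θ ++ U → (1 ≤ a ∧ a ≤ c) ∨ (a ∈ Θ ∧ c < a) := by
      intro a ha
      rcases List.mem_append.1 ha with ha | ha
      · rcases List.mem_append.1 ha with ha | ha
        · exact Or.inl (mem_iota.1 ha)
        · exact Or.inr ⟨ha, hΘ a ha⟩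
      · exact Or.inl (hU a ha)
    refine ⟨fun a => if a ≤ c then φ a else ψ a, fun a ha b hb hab => ?_, ?_⟩
    · rcases hmem a ha with ha | ha <;> rcases hmem b hb with hb | hb
      · simpa [ha.2, hb.2] using hφ ha hb hab
      · have := (hm ha).2.trans_lt (hψh b hb.1)
        simpa [ha.2, hb.2.not_ge] using this
      · omega
      · simpa [ha.2.not_ge, hb.2.not_ge] using hψ ha.1 hb.1 hab
    · rw [List.map_append, List.map_append]
      have e₁ : (iota c).map (fun a => if a ≤ c then φ a else ψ a) = (iota c).map φ :=
        List.map_congr_left fun a ha => if_pos (mem_iota.1 ha).2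
      have e₂ : Θ.map (fun a => if a ≤ c then φ a else ψ a) = Θ.map ψ :=
        List.map_congr_left fun a ha => if_neg (hΘ a ha).not_ge
      have e₃ : U.map (fun a => if a ≤ c then φ a else ψ a) = U.map φ :=
        List.map_congr_left fun a ha => if_pos (hU a ha).2
      rw [e₁, e₂, e₃]
      exact (hi.append hw₁).append hv

theorem map_succ_sublist_rotateFrom {Θ w v L : List ℕ}
    (hL : ∀ a ∈ L, 1 ≤ a ∧ a < height Θ w) :
    (L.map (· + 1)).Sublist (rotateFrom Θ w v) ↔ L.Sublist v := by
  induction v generalizing w L with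
  | nil => simp [rotateFrom]
  | cons b v ih =>
    have hle : height Θ w ≤ height Θ (w ++ [b]) := height_mono (List.sublist_append_left _ _)
    have ih' : ∀ L' : List ℕ, L' ⊆ L →
        ((L'.map (· + 1)).Sublist (rotateFrom Θ (w ++ [b]) v) ↔ L'.Sublist v) := fun L' h =>
      ih fun a ha => ⟨(hL a (h ha)).1, (hL a (h ha)).2.trans_le hle⟩
    cases L with
    | nil => simp
    | cons a L =>
      have ha := hL a (by simp)
      have hab : a + 1 = cyc (height Θ w) b ↔ a = b := by
        unfold cyc
        split_ifs <;> omega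
      have ih₁ := ih' (a :: L) (List.Subset.refl _)
      have ih₂ := ih' L (List.subset_cons_self _ _)
      rw [List.map_cons] at ih₁
      rw [rotateFrom, List.map_cons]
      by_cases h : a = b
      · rw [hab.2 h, h, List.cons_sublist_cons, List.cons_sublist_cons, ih₂]
      · rw [List.sublist_cons_iff, List.sublist_cons_iff, ih₁]
        simp [hab, h]

theorem containsBelow_rotateFrom {Θ U π : List ℕ} {c : ℕ}
    (hU : ∀ a ∈ U, 1 ≤ a ∧ a < c) :
    ContainsBelow Θ c (U.map (· + 1)) (rotateFrom Θ [] π) ↔ ContainsBelow Θ c U π := by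
  constructor
  · rintro ⟨w', v', φ, h, hφ, hm, hs⟩
    obtain ⟨w, rfl⟩ := rotateFrom_surjective Θ [] w'
    obtain ⟨v, rfl⟩ := rotateFrom_surjective Θ w v'
    have hπ : π = w ++ v := rotateFrom_injective Θ [] (by simpa [rotateFrom_append] using h)
    rw [(height_rotateFrom Θ w).1] at hm
    have hb : ∀ a, 1 ≤ a → a < c → 1 ≤ φ (a + 1) - 1 ∧ φ (a + 1) - 1 < height Θ w := by
      intro a h₁ h₂
      have h₃ := hφ (a := 1) (b := a + 1) ⟨le_rfl, by omega⟩ ⟨by omega, by omega⟩ (by omega)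
      have h₄ := hm (x := 1) ⟨le_rfl, by omega⟩
      have h₅ := hm (x := a + 1) ⟨by omega, by omega⟩
      simp only [Set.mem_Icc] at h₄ h₅
      omega
    refine ⟨w, v, fun a => if a < c then φ (a + 1) - 1 else height Θ w, hπ, ?_, ?_, ?_⟩
    · intro a ha b hb' hab
      simp only [Set.mem_Icc] at ha hb'
      have h₁ := hb a ha.1 (by omega)
      by_cases h₂ : b < c
      · have h₃ := hφ (a := a + 1) (b := b + 1) ⟨by omega, by omega⟩ ⟨by omega, by omega⟩
          (by omega)
        simp only [if_pos h₂, if_pos (hab.trans h₂)]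
        omega
      · simp only [if_neg h₂, if_pos (show a < c by omega)]
        omega
    · intro a ha
      simp only [Set.mem_Icc] at ha ⊢
      by_cases h₂ : a < c
      · have := hb a ha.1 h₂
        simp only [if_pos h₂]
        omega
      · have := hm (x := a) ha
        simp only [Set.mem_Icc] at this
        simp only [if_neg h₂]
        omega
    · rw [← map_succ_sublist_rotateFrom (Θ := Θ) (w := w)]
      · convert hs using 1
        rw [List.map_map, List.map_map]
        refine List.map_congr_left fun a ha => ?_
        have h₁ := hU a ha
        have h₂ := hb a h₁.1 h₁.2
        simp only [Function.comp_apply, if_pos h₁.2]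
        omega
      · intro a ha
        obtain ⟨b, hb', rfl⟩ := List.mem_map.1 ha
        have h₁ := hU b hb'
        simpa only [if_pos h₁.2] using hb b h₁.1 h₁.2
  · rintro ⟨w, v, φ, rfl, hφ, hm, hs⟩
    have hb : ∀ a, 1 ≤ a → a < c → 1 ≤ φ a ∧ φ a < height Θ w := by
      intro a h₁ h₂
      have h₃ := hφ (a := a) (b := c) ⟨h₁, h₂.le⟩ ⟨by omega, le_rfl⟩ h₂
      have h₄ := hm (x := a) ⟨h₁, h₂.le⟩
      have h₅ := hm (x := c) ⟨by omega, le_rfl⟩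
      simp only [Set.mem_Icc] at h₄ h₅
      omega
    refine ⟨rotateFrom Θ [] w, rotateFrom Θ w v,
      fun a => if a = 1 then 1 else φ (a - 1) + 1, by simp [rotateFrom_append], ?_, ?_, ?_⟩
    · intro a ha b hb' hab
      simp only [Set.mem_Icc] at ha hb'
      have h₁ := hb (b - 1) (by omega) (by omega)
      by_cases h₂ : a = 1
      · simp only [if_pos h₂, if_neg (show b ≠ 1 by omega)]
        omega
      · have h₃ := hφ (a := a - 1) (b := b - 1) ⟨by omega, by omega⟩ ⟨by omega, by omega⟩
          (by omega)
        simp only [if_neg h₂, if_neg (show b ≠ 1 by omega)]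
        omega
    · intro a ha
      rw [(height_rotateFrom Θ w).1]
      simp only [Set.mem_Icc] at ha ⊢
      by_cases h₂ : a = 1
      · have := hm (x := a) ha
        simp only [Set.mem_Icc] at this
        simp only [if_pos h₂]
        omega
      · have := hb (a - 1) (by omega) (by omega)
        simp only [if_neg h₂]
        omega
    · rw [← map_succ_sublist_rotateFrom (Θ := Θ) (w := w)] at hs
      · convert hs using 1
        rw [List.map_map, List.map_map]
        refine List.map_congr_left fun a ha => ?_
        have h₁ := hU a ha
        simp only [Function.comp_apply, if_neg (show a + 1 ≠ 1 by omega), Nat.add_sub_cancel]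
      · intro a ha
        obtain ⟨b, hb', rfl⟩ := List.mem_map.1 ha
        have h₁ := hU b hb'
        exact hb b h₁.1 h₁.2

theorem patEquiv_shift {Θ U : List ℕ} {c : ℕ} (hc : 1 ≤ c) (hΘ : ∀ a ∈ Θ, c < a)
    (hU : ∀ a ∈ U, 1 ≤ a ∧ a < c) :
    PatEquiv (iota c ++ Θ ++ U) (iota c ++ Θ ++ U.map (· + 1)) := by
  intro n
  have hU' : ∀ a ∈ U.map (· + 1), 1 ≤ a ∧ a ≤ c := by
    intro a ha
    obtain ⟨b, hb, rfl⟩ := List.mem_map.1 ha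
    have := hU b hb
    omega
  have key : ∀ π, (rotateFrom Θ [] π).length = n ∧ IsCanonicalSeq (rotateFrom Θ [] π) ∧
      AvoidsPat (rotateFrom Θ [] π) (iota c ++ Θ ++ U.map (· + 1)) ↔
      π.length = n ∧ IsCanonicalSeq π ∧ AvoidsPat π (iota c ++ Θ ++ U) := by
    intro π
    rw [length_rotateFrom, isCanonicalSeq_rotateFrom]
    refine and_congr_right fun _ => and_congr_right fun hπ => not_congr ?_
    rw [containsPat_iff_containsBelow hc hΘ hU' (isCanonicalSeq_rotateFrom.2 hπ),
      containsPat_iff_containsBelow hc hΘ (fun a ha => ⟨(hU a ha).1, (hU a ha).2.le⟩) hπ,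
      containsBelow_rotateFrom hU]
  unfold pAvoid
  rw [← Set.ncard_image_of_injective _ (rotateFrom_injective Θ [])]
  congr 1
  ext π
  obtain ⟨π, rfl⟩ := rotateFrom_surjective Θ [] π
  rw [(rotateFrom_injective Θ []).mem_set_image]
  exact (key π).symm

/-- The word `s₁^{r₁} ⋯ s_m^{r_m}`. -/
def powerWord {m : ℕ} (r s : Fin m → ℕ) : List (List ℕ) :=
  List.ofFn fun i => List.replicate (r i) (s i)

theorem iota_append_drop {c k : ℕ} (h : c ≤ k) : iota k = iota c ++ (iota k).drop c := by
  have : (iota k).take c = iota c := by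
    simp [iota, ← List.map_take, List.take_range, h]
  rw [← this, List.take_append_drop]

theorem lt_of_mem_drop_iota {c k a : ℕ} (h : a ∈ (iota k).drop c) : c < a := by
  obtain ⟨i, hi, rfl⟩ := List.mem_iff_getElem.1 h
  simp [iota]

theorem patEquiv_shift_tail {k m : ℕ} {s r : Fin m → ℕ} {τ : List ℕ} (hτ : ∀ a ∈ τ, 1 ≤ a)
    (hs : ∀ i, 1 ≤ s i) (p : Fin m) (hp : ∀ i < p, k - p < s i)
    (hp' : ∀ i, p ≤ i → s i < k - p) :
    PatEquiv (iota k ++ τ.map (· + k) ++ (powerWord r s).flatten)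
      (iota k ++ τ.map (· + k) ++
        (powerWord r fun i => if i < p then s i else s i + 1).flatten) := by
  have hc : 1 ≤ k - p := by
    have := hp' p le_rfl
    omega
  have h₁ : (powerWord r fun i => if i < p then s i else s i + 1).take p =
      (powerWord r s).take p := by
    refine List.ext_getElem (by simp [powerWord]) fun i hi hi' => ?_
    have h : i < p := by simp at hi; omega
    simp [powerWord, ← Fin.val_fin_lt, h]
  have h₂ : (powerWord r fun i => if i < p then s i else s i + 1).drop p =
      ((powerWord r s).drop p).map (List.map (· + 1)) := by
    refine List.ext_getElem (by simp [powerWord]) fun i hi hi' => ?_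
    simp [powerWord, ← Fin.val_fin_lt]
  have key := patEquiv_shift (U := ((powerWord r s).drop p).flatten) hc
    (Θ := (iota k).drop (k - p) ++ τ.map (· + k) ++ ((powerWord r s).take p).flatten) ?_ ?_
  · have h₃ : ∀ q : List (List ℕ), iota k ++ τ.map (· + k) ++ q.flatten =
        iota (k - p) ++ ((iota k).drop (k - p) ++ τ.map (· + k) ++ (q.take p).flatten) ++
          (q.drop p).flatten := by
      intro q
      conv_lhs => rw [iota_append_drop (Nat.sub_le k p), ← List.take_append_drop p q]
      simp only [List.flatten_append, List.append_assoc]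
    rw [h₃, h₃ (powerWord r fun i => _), h₁, h₂, ← List.map_flatten]
    exact key
  · intro a ha
    simp only [List.mem_append, List.mem_map, List.mem_flatten] at ha
    rcases ha with (ha | ⟨b, hb, rfl⟩) | ⟨l, hl, ha⟩
    · exact lt_of_mem_drop_iota ha
    · have := hτ b hb
      omega
    · obtain ⟨i, hi, rfl⟩ := List.mem_iff_getElem.1 hl
      have hi' : i < p := by simp at hi; omega
      simp only [powerWord, List.getElem_take, List.getElem_ofFn, List.mem_replicate] at ha
      rw [ha.2]
      exact hp _ hi'
  · intro a ha
    obtain ⟨l, hl, ha⟩ := List.mem_flatten.1 ha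
    obtain ⟨i, hi, rfl⟩ := List.mem_iff_getElem.1 hl
    simp only [powerWord, List.getElem_drop, List.getElem_ofFn, List.mem_replicate] at ha
    rw [ha.2]
    exact ⟨hs _, hp' _ (by simp [Fin.le_def])⟩

theorem StrictAnti.le_sub {k m : ℕ} {s : Fin m → ℕ} (hs : StrictAnti s) (hsk : ∀ i, s i ≤ k)
    (i : Fin m) : s i + i ≤ k := by
  obtain ⟨i, hi⟩ := i
  induction i with
  | zero => simpa using hsk ⟨0, hi⟩
  | succ i ih =>
    have h₁ := ih (by omega)
    have h₂ := hs (a := ⟨i, by omega⟩) (b := ⟨i + 1, hi⟩) (by simp [Fin.lt_def])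
    simp only at h₁ ⊢
    omega

theorem patEquiv_maximal {k m : ℕ} {r : Fin m → ℕ} {τ : List ℕ} (hτ : ∀ a ∈ τ, 1 ≤ a)
    (s : Fin m → ℕ) (hs : StrictAnti s) (hsk : ∀ i, 1 ≤ s i ∧ s i ≤ k) :
    PatEquiv (iota k ++ τ.map (· + k) ++ (powerWord r s).flatten)
      (iota k ++ τ.map (· + k) ++ (powerWord r fun i => k - i).flatten) := by
  induction hN : ∑ i, (k - s i) using Nat.strong_induction_on generalizing s with
  | _ N ih =>
    have hle := hs.le_sub fun i => (hsk i).2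
    by_cases hmax : ∀ i, s i = k - i
    · rw [funext hmax]
      exact fun n => rfl
    push Not at hmax
    obtain ⟨p, hp, hmin⟩ :=
      WellFounded.has_min (wellFounded_lt (α := Fin m)) {i | s i ≠ k - i} hmax
    have hpk : s p < k - p := by
      have := hle p
      have : s p ≠ k - p := hp
      omega
    have hlow : ∀ i < p, k - p < s i := by
      intro i hi
      have h₁ : s i = k - i := by
        by_contra h
        exact hmin i h hi
      have h₂ : (i : ℕ) < p := hi
      omega
    have hhigh : ∀ i, p ≤ i → s i < k - p := fun i hi => (hs.antitone hi).trans_lt hpk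
    have hstep := patEquiv_shift_tail (r := r) hτ (fun i => (hsk i).1) p hlow hhigh
    have hs' : StrictAnti fun i => if i < p then s i else s i + 1 := by
      intro i j hij
      have h₁ := hs hij
      by_cases hj : j < p
      · simpa [hj, hij.trans hj] using h₁
      · have h₂ := hhigh j (not_lt.1 hj)
        by_cases hi : i < p
        · have h₃ := hlow i hi
          simp only [hi, hj, if_true, if_false]
          omega
        · simpa [hi, hj] using h₁
    have hsk' : ∀ i, 1 ≤ (if i < p then s i else s i + 1) ∧
        (if i < p then s i else s i + 1) ≤ k := by
      intro i
      by_cases hi : i < p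
      · simpa [hi] using hsk i
      · have := hhigh i (not_lt.1 hi)
        simp only [hi, if_false]
        omega
    have hlt : ∑ i, (k - if i < p then s i else s i + 1) < N := by
      rw [← hN]
      refine Finset.sum_lt_sum (fun i _ => ?_) ⟨p, Finset.mem_univ _, ?_⟩
      · split_ifs <;> omega
      · simp only [lt_irrefl, if_false]
        omega
    exact fun n => (hstep n).trans (ih _ hlt _ hs' hsk' rfl n)

/-- For strictly decreasing sequences s, t over {1,…,k} and
positive multiplicities r, the patterns 1…k(τ+k)S and 1…k(τ+k)T are
equivalent, where S = s₁^{r₁}⋯s_m^{r_m} and T = t₁^{r₁}⋯t_m^{r_m}. -/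
theorem statement5 (k m : ℕ) (hk : 1 ≤ k) (s t r : Fin m → ℕ)
    (hs : StrictAnti s) (ht : StrictAnti t)
    (hsk : ∀ i, 1 ≤ s i ∧ s i ≤ k) (htk : ∀ i, 1 ≤ t i ∧ t i ≤ k)
    (hr : ∀ i, 1 ≤ r i) (τ : List ℕ) (hτ : IsCanonicalSeq τ) :
    PatEquiv
      (iota k ++ τ.map (· + k) ++ (List.ofFn fun i => List.replicate (r i) (s i)).flatten)
      (iota k ++ τ.map (· + k) ++ (List.ofFn fun i => List.replicate (r i) (t i)).flatten) := by
  have hτ' : ∀ a ∈ τ, 1 ≤ a := fun a ha => hτ.one_le ha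
  exact fun n => (patEquiv_maximal (r := r) hτ' s hs hsk n).trans
    (patEquiv_maximal (r := r) hτ' t ht htk n).symm
end
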